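/- For every sequence (h_n)_{n∈ℕ} of elements of the commutator subgroup of Homeo(ℝ²), there exists a subset S of Homeo(ℝ²) of cardinality 9 such that, for every n, h_n can be expressed as a product of at most 26n + 12 elements each of which lies in S or is the inverse of an element of S. -/

import Mathlib

open Pointwise

instance instGroupHomeomorph (X : Type*) [TopologicalSpace X] : Group (X ≃ₜ X) where
  mul f g := g.trans f
  one := Homeomorph.refl X
  inv := Homeomorph.symm
  mul_assoc _ _ _ := Homeomorph.ext fun _ => rfl
  one_mul _ := Homeomorph.ext fun _ => rfl
  mul_one _ := Homeomorph.ext fun _ => rfl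
  inv_mul_cancel f := Homeomorph.ext fun x => f.symm_apply_apply x

namespace PlaneHomeo

open Set Filter Topology

section Basic

variable {X : Type*} [TopologicalSpace X]

lemma mul_app (f g : X ≃ₜ X) (x : X) : (f * g) x = f (g x) := rfl

lemma one_app (x : X) : (1 : X ≃ₜ X) x = x := rfl

lemma inv_app_self (f : X ≃ₜ X) (x : X) : f⁻¹ (f x) = x := f.symm_apply_apply x

lemma app_inv_self (f : X ≃ₜ X) (x : X) : f (f⁻¹ x) = x := f.apply_symm_apply x

lemma inv_app_eq {f : X ≃ₜ X} {x y : X} : f⁻¹ x = y ↔ x = f y := f.symm_apply_eq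

/-- Build a homeomorphism from two mutually inverse continuous maps. -/
def mkHomeo (f g : X → X) (hf : Continuous f) (hg : Continuous g)
    (hgf : ∀ x, g (f x) = x) (hfg : ∀ x, f (g x) = x) : X ≃ₜ X where
  toFun := f
  invFun := g
  left_inv := hgf
  right_inv := hfg
  continuous_toFun := hf
  continuous_invFun := hg

/-- `f` is the identity off the set `A`. -/
def IdOff (f : X ≃ₜ X) (A : Set X) : Prop := ∀ x, x ∉ A → f x = x

lemma IdOff.mono {f : X ≃ₜ X} {A B : Set X} (h : IdOff f A) (hAB : A ⊆ B) : IdOff f B :=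
  fun x hx => h x fun hA => hx (hAB hA)

lemma idOff_one (A : Set X) : IdOff (1 : X ≃ₜ X) A := fun _ _ => rfl

lemma IdOff.inv {f : X ≃ₜ X} {A : Set X} (h : IdOff f A) : IdOff f⁻¹ A :=
  fun x hx => inv_app_eq.2 (h x hx).symm

lemma IdOff.mul {f g : X ≃ₜ X} {A : Set X} (hf : IdOff f A) (hg : IdOff g A) :
    IdOff (f * g) A := fun x hx => by rw [mul_app, hg x hx, hf x hx]

lemma IdOff.mem {f : X ≃ₜ X} {A : Set X} (h : IdOff f A) {x : X} (hx : x ∈ A) : f x ∈ A := by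
  by_contra hA
  exact hA (by rwa [f.injective (h _ hA)])

lemma IdOff.conj {f : X ≃ₜ X} {A : Set X} (h : IdOff f A) (g : X ≃ₜ X) :
    IdOff (g * f * g⁻¹) (g '' A) := fun x hx => by
  rw [mul_app, mul_app, h, app_inv_self]
  exact fun hA => hx ⟨_, hA, app_inv_self g x⟩

lemma IdOff.mul_comm {f g : X ≃ₜ X} {A : Set X} (hf : IdOff f A) (hg : ∀ x ∈ A, g x = x) :
    f * g = g * f := by
  ext x
  rw [mul_app, mul_app]
  by_cases hx : x ∈ A
  · rw [hg x hx, hg _ (hf.mem hx)]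
  · rw [hf x hx, hf]
    intro hA
    exact hx (by rwa [g.injective (hg _ hA)] at hA)

/-- Homeomorphisms supported on the members of a locally finite family of pairwise disjoint closed
sets can be performed simultaneously. -/
theorem exists_glue {ι : Type*} (C : ι → Set X) (hcl : ∀ i, IsClosed (C i))
    (hd : ∀ i j x, x ∈ C i → x ∈ C j → i = j) (hlf : LocallyFinite C) (g : ι → X ≃ₜ X)
    (hg : ∀ i, IdOff (g i) (C i)) :
    ∃ F : X ≃ₜ X, (∀ i, ∀ x ∈ C i, F x = g i x) ∧ ∀ x, (∀ i, x ∉ C i) → F x = x := by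
  classical
  let Φ : (ι → X ≃ₜ X) → X → X := fun g x => if h : ∃ i, x ∈ C i then g h.choose x else x
  have hΦ1 : ∀ g i x, x ∈ C i → Φ g x = g i x := by
    intro g i x hx
    have h : ∃ i, x ∈ C i := ⟨i, hx⟩
    have : h.choose = i := hd _ _ x h.choose_spec hx
    simp only [Φ, dif_pos h, this]
  have hΦ2 : ∀ g x, (∀ i, x ∉ C i) → Φ g x = x := by
    intro g x hx
    have h : ¬ ∃ i, x ∈ C i := by push Not; exact hx
    simp only [Φ, dif_neg h]
  have hcont : ∀ g : ι → X ≃ₜ X, (∀ i, IdOff (g i) (C i)) → Continuous (Φ g) := by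
    intro g hg
    rw [continuous_iff_continuousAt]
    intro x
    by_cases hx : ∃ i, x ∈ C i
    · obtain ⟨i, hi⟩ := hx
      have hclosed : IsClosed (⋃ k : {k // k ≠ i}, C k) :=
        (hlf.comp_injective Subtype.val_injective).isClosed_iUnion fun k => hcl k
      have hmem : x ∈ (⋃ k : {k // k ≠ i}, C k)ᶜ := by
        simp only [mem_compl_iff, mem_iUnion, not_exists]
        exact fun k hk => k.2 (hd _ _ x hk hi)
      refine ((g i).continuous.continuousAt (x := x)).congr ?_
      filter_upwards [hclosed.isOpen_compl.mem_nhds hmem] with y hy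
      by_cases hyi : y ∈ C i
      · exact (hΦ1 g i y hyi).symm
      · rw [hg i y hyi, hΦ2]
        intro k hk
        by_cases hki : k = i
        · exact hyi (hki ▸ hk)
        · exact hy (mem_iUnion.2 ⟨⟨k, hki⟩, hk⟩)
    · push Not at hx
      have hclosed : IsClosed (⋃ k, C k) := hlf.isClosed_iUnion hcl
      refine (continuousAt_id (x := x)).congr ?_
      filter_upwards [hclosed.isOpen_compl.mem_nhds (by simpa using hx)] with y hy
      exact (hΦ2 g y (by simpa using hy)).symm
  have hinv : ∀ g g' : ι → X ≃ₜ X, (∀ i, IdOff (g i) (C i)) → (∀ i x, g' i (g i x) = x) →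
      ∀ x, Φ g' (Φ g x) = x := by
    intro g g' hg hgg x
    by_cases hx : ∃ i, x ∈ C i
    · obtain ⟨i, hi⟩ := hx
      rw [hΦ1 g i x hi, hΦ1 g' i _ ((hg i).mem hi), hgg]
    · push Not at hx
      rw [hΦ2 g x hx, hΦ2 g' x hx]
  exact ⟨mkHomeo (Φ g) (Φ fun i => (g i)⁻¹) (hcont g hg) (hcont _ fun i => (hg i).inv)
    (hinv _ _ hg fun i => inv_app_self _) (hinv _ _ (fun i => (hg i).inv) fun i => app_inv_self _),
    hΦ1 g, hΦ2 g⟩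

end Basic

section Radial

/-- Piecewise linear interpolation of an increasing sequence. -/
theorem exists_orderIso_interpolating (u : ℕ → ℝ) (hu : StrictMono u) (h0 : u 0 = 0)
    (hinf : ∀ M, ∃ k, M < u k) :
    ∃ ρ : ℝ ≃o ℝ, ρ 0 = 0 ∧
      ∀ k : ℕ, ∀ t : ℝ, k ≤ t → t ≤ k + 1 → ρ t = u k + (t - k) * (u (k + 1) - u k) := by
  let f : ℝ → ℝ := fun t =>
    if t < 0 then t else u ⌊t⌋₊ + (t - ⌊t⌋₊) * (u (⌊t⌋₊ + 1) - u ⌊t⌋₊)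
  have hpos : ∀ k, 0 < u (k + 1) - u k := fun k => sub_pos.2 (hu (Nat.lt_succ_self k))
  have hf1 : ∀ k : ℕ, ∀ t : ℝ, k ≤ t → t < k + 1 → f t = u k + (t - k) * (u (k + 1) - u k) := by
    intro k t h1 h2
    have hk : ⌊t⌋₊ = k := (Nat.floor_eq_iff (le_trans k.cast_nonneg h1)).2 ⟨h1, h2⟩
    have h0 : ¬ t < 0 := not_lt.2 (le_trans k.cast_nonneg h1)
    simp only [f, if_neg h0, hk]
  have hf2 : ∀ k : ℕ, ∀ t : ℝ, k ≤ t → t ≤ k + 1 → f t = u k + (t - k) * (u (k + 1) - u k) := by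
    intro k t h1 h2
    rcases h2.lt_or_eq with h | h
    · exact hf1 k t h1 h
    · rw [hf1 (k + 1) t (by rw [h]; push_cast; rfl) (by rw [h]; push_cast; linarith), h]
      push_cast; ring
  have hneg : ∀ t, t < 0 → f t = t := fun t ht => by simp only [f, if_pos ht]
  have hfl : ∀ t : ℝ, 0 ≤ t → ∃ k : ℕ, (k : ℝ) ≤ t ∧ t < k + 1 := fun t ht =>
    ⟨⌊t⌋₊, Nat.floor_le ht, Nat.lt_floor_add_one t⟩
  have hmono : StrictMono f := by
    intro s t hst
    rcases lt_or_ge t 0 with ht | ht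
    · rw [hneg t ht, hneg s (hst.trans ht)]; exact hst
    obtain ⟨k, hk1, hk2⟩ := hfl t ht
    have huk : 0 ≤ u k := h0 ▸ hu.monotone (Nat.zero_le k)
    rcases lt_or_ge s 0 with hs | hs
    · rw [hneg s hs, hf1 k t hk1 hk2]
      nlinarith [hpos k]
    obtain ⟨l, hl1, hl2⟩ := hfl s hs
    rw [hf1 k t hk1 hk2, hf1 l s hl1 hl2]
    have hlk : l ≤ k := by
      have : (l : ℝ) < k + 1 := by linarith
      exact_mod_cast Nat.lt_succ_iff.1 (by exact_mod_cast this)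
    rcases hlk.lt_or_eq with h | h
    · have h1 : u (l + 1) ≤ u k := hu.monotone h
      nlinarith [hpos k, hpos l]
    · subst h
      nlinarith [hpos l]
  have hsurj : Function.Surjective f := by
    intro y
    rcases lt_or_ge y 0 with hy | hy
    · exact ⟨y, hneg y hy⟩
    classical
    have hex := hinf y
    obtain ⟨k, hk⟩ : ∃ k, Nat.find hex = k + 1 := by
      refine Nat.exists_eq_succ_of_ne_zero fun h => ?_
      have := Nat.find_spec hex
      rw [h, h0] at this
      linarith
    have h1 : y < u (k + 1) := hk ▸ Nat.find_spec hex
    have h2 : u k ≤ y := not_lt.1 (Nat.find_min hex (by omega))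
    have hd := hpos k
    have h3 : 0 ≤ (y - u k) / (u (k + 1) - u k) := div_nonneg (by linarith) hd.le
    have h4 : (y - u k) / (u (k + 1) - u k) < 1 := (div_lt_one hd).2 (by linarith)
    refine ⟨k + (y - u k) / (u (k + 1) - u k), ?_⟩
    rw [hf1 k _ (by linarith) (by linarith)]
    field_simp
    ring
  refine ⟨hmono.orderIsoOfSurjective f hsurj, ?_, ?_⟩
  · have := hf2 0 0 (by simp) (by simp)
    simpa [h0] using this
  · intro k t h1 h2
    simpa using hf2 k t h1 h2

variable {E : Type*} [NormedAddCommGroup E] [NormedSpace ℝ E]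

/-- The radial map with profile `ρ`. -/
noncomputable def radialFun (ρ : ℝ ≃o ℝ) (x : E) : E := (ρ ‖x‖ / ‖x‖) • x

lemma orderIso_nonneg {ρ : ℝ ≃o ℝ} (h0 : ρ 0 = 0) {t : ℝ} (ht : 0 ≤ t) : 0 ≤ ρ t :=
  h0 ▸ ρ.monotone ht

lemma norm_radialFun {ρ : ℝ ≃o ℝ} (h0 : ρ 0 = 0) (x : E) : ‖radialFun ρ x‖ = ρ ‖x‖ := by
  rcases eq_or_ne x 0 with rfl | hx
  · simp [radialFun, h0]
  · have := norm_pos_iff.2 hx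
    rw [radialFun, norm_smul, Real.norm_eq_abs,
      abs_of_nonneg (div_nonneg (orderIso_nonneg h0 this.le) this.le)]
    field_simp

lemma continuous_radialFun {ρ : ℝ ≃o ℝ} (h0 : ρ 0 = 0) :
    Continuous (radialFun ρ : E → E) := by
  rw [continuous_iff_continuousAt]
  intro x
  rcases eq_or_ne x 0 with rfl | hx
  · rw [ContinuousAt, show radialFun ρ (0 : E) = 0 by simp [radialFun],
      tendsto_zero_iff_norm_tendsto_zero]
    simp only [norm_radialFun h0]
    have : Continuous fun x : E => ρ ‖x‖ := ρ.continuous.comp continuous_norm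
    simpa [h0] using this.tendsto (0 : E)
  · have hρ : Continuous ρ := ρ.continuous
    exact ((hρ.continuousAt.comp continuousAt_id.norm).div continuousAt_id.norm
      (norm_ne_zero_iff.2 hx)).smul continuousAt_id

lemma radialFun_radialFun {ρ σ : ℝ ≃o ℝ} (h0 : ρ 0 = 0) (hσ : ∀ t, σ (ρ t) = t) (x : E) :
    radialFun σ (radialFun ρ x) = x := by
  rcases eq_or_ne x 0 with rfl | hx
  · simp [radialFun]
  · have h1 := norm_pos_iff.2 hx
    have h2 : 0 < ρ ‖x‖ := h0 ▸ ρ.strictMono h1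
    rw [radialFun, norm_radialFun h0, hσ, radialFun, smul_smul]
    rw [show ‖x‖ / ρ ‖x‖ * (ρ ‖x‖ / ‖x‖) = 1 by field_simp, one_smul]

/-- The radial homeomorphism with profile `ρ`. -/
noncomputable def radial (ρ : ℝ ≃o ℝ) (h0 : ρ 0 = 0) : E ≃ₜ E :=
  mkHomeo (radialFun ρ) (radialFun ρ.symm) (continuous_radialFun h0)
    (continuous_radialFun (by rw [ρ.symm_apply_eq, h0]))
    (radialFun_radialFun h0 ρ.symm_apply_apply)
    (radialFun_radialFun (by rw [ρ.symm_apply_eq, h0]) ρ.apply_symm_apply)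

lemma norm_radial (ρ : ℝ ≃o ℝ) (h0 : ρ 0 = 0) (x : E) : ‖radial ρ h0 x‖ = ρ ‖x‖ :=
  norm_radialFun h0 x

lemma norm_radial_inv (ρ : ℝ ≃o ℝ) (h0 : ρ 0 = 0) (x : E) :
    ‖(radial ρ h0)⁻¹ x‖ = ρ.symm ‖x‖ :=
  norm_radialFun (by rw [ρ.symm_apply_eq, h0]) x

lemma radial_congr {ρ σ : ℝ ≃o ℝ} (h0 : ρ 0 = 0) (h0' : σ 0 = 0) {x : E} (h : ρ ‖x‖ = σ ‖x‖) :
    radial ρ h0 x = radial σ h0' x := by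
  change radialFun ρ x = radialFun σ x
  rw [radialFun, h, radialFun]

lemma radial_eq_self {ρ : ℝ ≃o ℝ} (h0 : ρ 0 = 0) {x : E} (h : ρ ‖x‖ = ‖x‖) :
    radial ρ h0 x = x := by
  rcases eq_or_ne x 0 with rfl | hx
  · change radialFun ρ 0 = 0
    simp [radialFun]
  · change radialFun ρ x = x
    rw [radialFun, h, div_self (norm_ne_zero_iff.2 hx), one_smul]

end Radial

section Cut

variable {E : Type*} [NormedAddCommGroup E] [NormedSpace ℝ E] [Nontrivial E]

/-- A homeomorphism which is the identity on a shell preserves the ball inside it. -/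
theorem norm_le_of_idOn_shell {f : E ≃ₜ E} {a b : ℝ} (hab : a < b)
    (hf : ∀ x, a ≤ ‖x‖ → ‖x‖ ≤ b → f x = x) {x : E} (hx : ‖x‖ ≤ b) : ‖f x‖ ≤ b := by
  rcases lt_or_ge b 0 with hb | hb
  · exact absurd hx (not_le.2 (hb.trans_le (norm_nonneg x)))
  rcases hx.lt_or_eq with hlt | heq
  swap
  · rw [hf x (heq ▸ hab.le) heq.le, heq]
  have hb' : 0 < b := (norm_nonneg x).trans_lt hlt
  obtain ⟨p, hp⟩ := exists_norm_eq E (show 0 ≤ max 0 ((a + b) / 2) from le_max_left _ _)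
  have hpb : ‖p‖ < b := by rw [hp]; exact max_lt hb' (by linarith)
  have hpa : a ≤ ‖p‖ := by rw [hp]; exact le_trans (by linarith) (le_max_right _ _)
  have hconn : IsPreconnected (f '' Metric.ball (0 : E) b) :=
    (convex_ball (0 : E) b).isPreconnected.image f f.continuous.continuousOn
  by_contra hcon
  have hcont : ContinuousOn (fun y : E => ‖y‖) (f '' Metric.ball (0 : E) b) :=
    continuous_norm.continuousOn
  have h1 : f p ∈ f '' Metric.ball (0 : E) b := ⟨p, by simpa using hpb, rfl⟩
  have h2 : f x ∈ f '' Metric.ball (0 : E) b := ⟨x, by simpa using hlt, rfl⟩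
  obtain ⟨y, ⟨z, hz, hzy⟩, hy⟩ := hconn.intermediate_value h1 h2 hcont
    (show b ∈ Icc ‖f p‖ ‖f x‖ from ⟨by rw [hf p hpa hpb.le]; exact hpb.le, (not_le.1 hcon).le⟩)
  have hyy : f y = y := hf y (by simp only at hy; linarith) (by simp only at hy; linarith)
  have : z = y := f.injective (by rw [hzy, hyy])
  subst this
  simp only at hy
  simp at hz
  linarith

omit [NormedSpace ℝ E] [Nontrivial E] in
lemma inv_idOn_shell {f : E ≃ₜ E} {a b : ℝ}
    (hf : ∀ x, a ≤ ‖x‖ → ‖x‖ ≤ b → f x = x) (x : E) (h1 : a ≤ ‖x‖) (h2 : ‖x‖ ≤ b) :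
    f⁻¹ x = x := inv_app_eq.2 (hf x h1 h2).symm

/-- A homeomorphism which is the identity on a shell can be truncated there. -/
theorem exists_cut {f : E ≃ₜ E} {a b : ℝ} (hab : a < b)
    (hf : ∀ x, a ≤ ‖x‖ → ‖x‖ ≤ b → f x = x) :
    ∃ g : E ≃ₜ E, (∀ x, ‖x‖ ≤ b → g x = f x) ∧ ∀ x, a ≤ ‖x‖ → g x = x := by
  classical
  have key : ∀ f : E ≃ₜ E, (∀ x, a ≤ ‖x‖ → ‖x‖ ≤ b → f x = x) →
      Continuous fun x => if ‖x‖ ≤ b then f x else x := by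
    intro f hf
    refine Continuous.if_le f.continuous continuous_id continuous_norm continuous_const ?_
    intro x hx
    exact hf x (hx ▸ hab.le) hx.le
  have hinv : ∀ f g : E ≃ₜ E, (∀ x, a ≤ ‖x‖ → ‖x‖ ≤ b → f x = x) → (∀ x, g (f x) = x) → ∀ x,
      (fun x => if ‖x‖ ≤ b then g x else x) ((fun x => if ‖x‖ ≤ b then f x else x) x) = x := by
    intro f g hf hgf x
    by_cases hx : ‖x‖ ≤ b
    · simp only [if_pos hx, if_pos (norm_le_of_idOn_shell hab hf hx), hgf]
    · simp only [if_neg hx]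
  refine ⟨mkHomeo _ _ (key f hf) (key f⁻¹ (inv_idOn_shell hf)) (hinv f f⁻¹ hf (inv_app_self f))
    (hinv f⁻¹ f (inv_idOn_shell hf) (app_inv_self f)), fun x hx => if_pos hx, fun x hx => ?_⟩
  change (if ‖x‖ ≤ b then f x else x) = x
  split_ifs with h
  · exact hf x hx h
  · rfl

end Cut

section Profiles

lemma exists_profile_add_eight : ∃ ρ : ℝ ≃o ℝ, ρ 0 = 0 ∧ ∀ t, 1 ≤ t → ρ t = t + 8 := by
  obtain ⟨ρ, h0, hρ⟩ := exists_orderIso_interpolating (fun k => if k = 0 then 0 else (k : ℝ) + 8)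
    (strictMono_nat_of_lt_succ fun k => by
      rcases k with _ | k
      · norm_num
      · simp)
    (by simp) (fun M => by
      obtain ⟨k, hk⟩ := exists_nat_gt M
      refine ⟨k + 1, ?_⟩
      simp only [Nat.add_eq_zero_iff, one_ne_zero, and_false, if_false]
      push_cast
      linarith)
  refine ⟨ρ, h0, fun t ht => ?_⟩
  have hk : 1 ≤ ⌊t⌋₊ := Nat.one_le_floor_iff _ |>.2 ht
  rw [hρ ⌊t⌋₊ t (Nat.floor_le (by linarith)) (Nat.lt_floor_add_one t).le, if_neg (by omega),
    if_neg (by omega)]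
  push_cast
  ring

lemma exists_periodic_profile (v : ℕ → ℝ) (h0 : v 0 = 0) (h16 : v 16 = 16)
    (hv : ∀ i < 16, v i < v (i + 1)) :
    ∃ ρ : ℝ ≃o ℝ, ρ 0 = 0 ∧ ∀ j i : ℕ, i < 16 → ∀ t : ℝ, 16 * j + i ≤ t → t ≤ 16 * j + i + 1 →
      ρ t = 16 * j + v i + (t - (16 * j + i)) * (v (i + 1) - v i) := by
  let u : ℕ → ℝ := fun k => 16 * (k / 16 : ℕ) + v (k % 16)
  have hu : ∀ j i : ℕ, i ≤ 16 → u (16 * j + i) = 16 * j + v i := by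
    intro j i hi
    rcases hi.lt_or_eq with hi | rfl
    · simp only [u, show (16 * j + i) / 16 = j by omega, show (16 * j + i) % 16 = i by omega]
    · simp only [u, show (16 * j + 16) / 16 = j + 1 by omega,
        show (16 * j + 16) % 16 = 0 by omega, h0, h16]
      push_cast
      ring
  have hdec : ∀ k : ℕ, ∃ j i : ℕ, i < 16 ∧ k = 16 * j + i := fun k =>
    ⟨k / 16, k % 16, Nat.mod_lt _ (by norm_num), by omega⟩
  have hmono : StrictMono u := strictMono_nat_of_lt_succ fun k => by
    obtain ⟨j, i, hi, rfl⟩ := hdec k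
    rw [hu j i hi.le, add_assoc, hu j (i + 1) hi]
    linarith [hv i hi]
  obtain ⟨ρ, hρ0, hρ⟩ := exists_orderIso_interpolating u hmono (by simpa [h0] using hu 0 0)
    (fun M => by
      obtain ⟨k, hk⟩ := exists_nat_gt M
      refine ⟨16 * k + 0, ?_⟩
      rw [hu k 0 (by norm_num), h0]
      have : (0 : ℝ) ≤ k := k.cast_nonneg
      linarith)
  refine ⟨ρ, hρ0, fun j i hi t h1 h2 => ?_⟩
  have h3 := hu j (i + 1) hi
  rw [← add_assoc] at h3
  rw [hρ (16 * j + i) t (by push_cast; exact h1) (by push_cast; exact h2), hu j i hi.le, h3]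
  push_cast
  ring

/-- A floor-type decomposition of a nonnegative real. -/
lemma exists_block {t : ℝ} (ht : 0 ≤ t) :
    ∃ j i : ℕ, i < 16 ∧ (16 * j + i : ℝ) ≤ t ∧ t < 16 * j + i + 1 := by
  refine ⟨⌊t⌋₊ / 16, ⌊t⌋₊ % 16, Nat.mod_lt _ (by norm_num), ?_⟩
  have h : (16 * (⌊t⌋₊ / 16 : ℕ) + (⌊t⌋₊ % 16 : ℕ) : ℝ) = ⌊t⌋₊ := by
    exact_mod_cast Nat.div_add_mod ⌊t⌋₊ 16
  rw [h]
  exact ⟨Nat.floor_le ht, Nat.lt_floor_add_one t⟩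

lemma exists_profile_switch : ∃ ρ : ℝ ≃o ℝ, ρ 0 = 0 ∧
    (∀ j : ℕ, ∀ t : ℝ, 16 * j + 2 ≤ t → t ≤ 16 * j + 6 → ρ t = t + 8) ∧
    ∀ t : ℝ, 0 ≤ t → (∀ j : ℕ, 16 * j + 1 ≤ t → 16 * j + 15 < t) → ρ t = t := by
  obtain ⟨ρ, h0, hρ⟩ := exists_periodic_profile
    (fun i => if i ≤ 1 then (i : ℝ) else if i ≤ 6 then i + 8 else if i ≤ 15 then 14 + (i - 6) / 9
      else i) (by simp) (by norm_num) (fun i hi => by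
      interval_cases i <;> norm_num)
  refine ⟨ρ, h0, fun j t h1 h2 => ?_, fun t ht h => ?_⟩
  · rcases le_total t (16 * j + 3) with h3 | h3
    · rw [hρ j 2 (by norm_num) t (by push_cast; linarith) (by push_cast; linarith)]
      norm_num
      ring
    rcases le_total t (16 * j + 4) with h4 | h4
    · rw [hρ j 3 (by norm_num) t (by push_cast; linarith) (by push_cast; linarith)]
      norm_num
      ring
    rcases le_total t (16 * j + 5) with h5 | h5
    · rw [hρ j 4 (by norm_num) t (by push_cast; linarith) (by push_cast; linarith)]
      norm_num
      ring
    · rw [hρ j 5 (by norm_num) t (by push_cast; linarith) (by push_cast; linarith)]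
      norm_num
      ring
  · obtain ⟨l, i, hi, h3, h4⟩ := exists_block ht
    rw [hρ l i hi t h3 h4.le]
    have hl := h l
    by_cases hi0 : i = 0
    · subst hi0
      norm_num
    · have hi1 : (1 : ℝ) ≤ i := by exact_mod_cast Nat.one_le_iff_ne_zero.2 hi0
      have hl' := hl (by linarith)
      have : (14 : ℝ) < i := by linarith
      have : 14 < i := by exact_mod_cast this
      obtain rfl : i = 15 := by omega
      norm_num

lemma exists_profile_push : ∃ ρ : ℝ ≃o ℝ, ρ 0 = 0 ∧ ∀ j : ℕ, ∀ t : ℝ,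
    16 * j + 1 ≤ t → t < 16 * j + 16 → 16 * j + 15 < ρ t ∧ ρ t < 16 * j + 16 := by
  obtain ⟨ρ, h0, hρ⟩ := exists_periodic_profile
    (fun i => if i = 0 then 0 else 15 + (i : ℝ) / 16) (by simp) (by norm_num) (fun i hi => by
      interval_cases i <;> norm_num)
  refine ⟨ρ, h0, fun j t h1 h2 => ?_⟩
  have ha := hρ j 1 (by norm_num) (16 * j + 1) (by norm_num) (by norm_num)
  have hb := hρ j 15 (by norm_num) (16 * j + 16) (by push_cast; linarith) (by push_cast; linarith)
  norm_num at ha hb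
  have hc : ρ (16 * j + 1) ≤ ρ t := ρ.monotone h1
  have hd : ρ t < ρ (16 * j + 16) := ρ.strictMono h2
  constructor <;> linarith

end Profiles

section Shells

variable {E : Type*} [NormedAddCommGroup E] [NormedSpace ℝ E]

/-- The `j`-th supporting shell. -/
def xShell (E : Type*) [NormedAddCommGroup E] (j : ℕ) : Set E :=
  {x | 16 * (j : ℝ) + 2 ≤ ‖x‖ ∧ ‖x‖ ≤ 16 * j + 6}

omit [NormedSpace ℝ E] in
lemma xShell_index_eq {i j : ℕ} {x : E} (hi : x ∈ xShell E i) (h1 : 16 * (j : ℝ) - 10 < ‖x‖)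
    (h2 : ‖x‖ < 16 * j + 18) : i = j := by
  obtain ⟨h3, h4⟩ := hi
  have h5 : (i : ℝ) < j + 1 := by linarith
  have h6 : (j : ℝ) < i + 1 := by linarith
  have h7 : i < j + 1 := by exact_mod_cast h5
  have h8 : j < i + 1 := by exact_mod_cast h6
  omega

variable [Nontrivial E]

/-- Restriction of a homeomorphism supported in the shells to a single shell. -/
lemma exists_restrict_xShell {G : E ≃ₜ E} (hG : ∀ x, (∀ i, x ∉ xShell E i) → G x = x) (j : ℕ) :
    ∃ f : E ≃ₜ E, IdOff f (xShell E j) ∧ ∀ x ∈ xShell E j, f x = G x := by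
  have hG' : ∀ x, 16 * (j : ℝ) - 10 < ‖x‖ → ‖x‖ < 16 * j + 18 → x ∉ xShell E j → G x = x :=
    fun x h1 h2 h3 => hG x fun i hi => h3 (xShell_index_eq hi h1 h2 ▸ hi)
  obtain ⟨c, hc1, hc2⟩ := exists_cut (f := G) (a := 16 * j + 13 / 2) (b := 16 * j + 7) (by linarith)
    fun x h1 h2 => hG' x (by linarith) (by linarith) fun h => by linarith [h.2]
  obtain ⟨d, hd1, hd2⟩ := exists_cut (f := G) (a := 16 * j - 19 / 2) (b := 16 * j - 9) (by linarith)
    fun x h1 h2 => hG' x (by linarith) (by linarith) fun h => by linarith [h.1]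
  have hd3 : ∀ x : E, 16 * j - 19 / 2 ≤ ‖x‖ → d⁻¹ x = x := fun x hx =>
    inv_app_eq.2 (hd2 x hx).symm
  refine ⟨c * d⁻¹, fun x hx => ?_, fun x hx => ?_⟩
  · rw [mul_app]
    rcases le_or_gt (16 * (j : ℝ) - 19 / 2) ‖x‖ with h | h
    · rw [hd3 x h]
      rcases le_or_gt (16 * (j : ℝ) + 7) ‖x‖ with h' | h'
      · exact hc2 x (by linarith)
      · rw [hc1 x h'.le, hG' x (by linarith) (by linarith) hx]
    · have h1 : ‖d⁻¹ x‖ ≤ 16 * j - 9 :=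
        norm_le_of_idOn_shell (f := d⁻¹) (a := 16 * j - 19 / 2) (by linarith)
          (fun x h1 _ => hd3 x h1) (by linarith)
      rw [hc1 _ (by linarith), ← hd1 _ h1, app_inv_self]
  · rw [mul_app, hd3 x (by linarith [hx.1]), hc1 x (by linarith [hx.2])]

omit [NormedSpace ℝ E] [Nontrivial E] in
lemma isClosed_xShell (j : ℕ) : IsClosed (xShell E j) :=
  (isClosed_le continuous_const continuous_norm).inter
    (isClosed_le continuous_norm continuous_const)

omit [NormedSpace ℝ E] [Nontrivial E] in
/-- Families of sets lying in concentric blocks, finitely many in each block, are locally finite. -/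
lemma locallyFinite_of_block {ι : Type*} (C : ι → Set E) (b : ι → ℕ)
    (hC : ∀ i, ∀ x ∈ C i, 16 * (b i : ℝ) ≤ ‖x‖)
    (hfin : ∀ n, {i | b i ≤ n ∧ (C i).Nonempty}.Finite) : LocallyFinite C := by
  intro x
  obtain ⟨n, hn⟩ := exists_nat_gt (‖x‖ + 1)
  refine ⟨{y | ‖y‖ < ‖x‖ + 1}, (isOpen_lt continuous_norm continuous_const).mem_nhds (by simp),
    (hfin n).subset ?_⟩
  rintro i ⟨y, hy1, hy2⟩
  refine ⟨?_, y, hy1⟩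
  have h1 := hC i y hy1
  have h2 : ‖y‖ < ‖x‖ + 1 := hy2
  have h3 : (0 : ℝ) ≤ b i := (b i).cast_nonneg
  have : (b i : ℝ) ≤ n := by linarith
  exact_mod_cast this

omit [NormedSpace ℝ E] [Nontrivial E] in
lemma exists_glue_xShell (f : ℕ → E ≃ₜ E) (hf : ∀ j, IdOff (f j) (xShell E j)) :
    ∃ F : E ≃ₜ E, (∀ j, ∀ x ∈ xShell E j, F x = f j x) ∧
      ∀ x, (∀ j, x ∉ xShell E j) → F x = x := by
  refine exists_glue _ isClosed_xShell (fun i j x hi hj => xShell_index_eq hi ?_ ?_)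
    (locallyFinite_of_block _ id (fun i x hx => ?_) fun n => ?_) f hf
  · linarith [hj.1]
  · linarith [hj.2]
  · have := hx.1
    simp only [id]
    linarith
  · exact (Set.finite_le_nat n).subset fun i hi => hi.1

end Shells

section Compressor

variable {E : Type*} [NormedAddCommGroup E]

/-- The zones in which the switch acts. -/
def zone (E : Type*) [NormedAddCommGroup E] : Set E :=
  {x | ∃ j : ℕ, 16 * (j : ℝ) + 1 ≤ ‖x‖ ∧ ‖x‖ ≤ 16 * j + 15}

lemma xShell_subset_zone (j : ℕ) : xShell E j ⊆ zone E := fun x hx =>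
  ⟨j, by linarith [hx.1], by linarith [hx.2]⟩

/-- The three auxiliary homeomorphisms: a shift `U`, a switched shift `T` and a push `τ`. -/
structure Gears (U T τ : E ≃ₜ E) : Prop where
  norm_U : ∀ x, 1 ≤ ‖x‖ → ‖U x‖ = ‖x‖ + 8
  norm_U_lt : ∀ x, ‖x‖ < 1 → ‖U x‖ < 9
  T_eq_U : ∀ j, ∀ x ∈ xShell E j, T x = U x
  T_eq_self : ∀ x, x ∉ zone E → T x = x
  norm_τ : ∀ j : ℕ, ∀ x, 16 * (j : ℝ) + 1 ≤ ‖x‖ → ‖x‖ < 16 * j + 16 →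
    16 * (j : ℝ) + 15 < ‖τ x‖ ∧ ‖τ x‖ < 16 * j + 16

theorem exists_gears [NormedSpace ℝ E] : ∃ U T τ : E ≃ₜ E, Gears U T τ := by
  obtain ⟨ρ, hρ0, hρ⟩ := exists_profile_add_eight
  obtain ⟨σ, hσ0, hσ1, hσ2⟩ := exists_profile_switch
  obtain ⟨π, hπ0, hπ⟩ := exists_profile_push
  refine ⟨radial ρ hρ0, radial σ hσ0, radial π hπ0, ?_, ?_, ?_, ?_, ?_⟩
  · intro x hx
    rw [norm_radial, hρ _ hx]
  · intro x hx
    rw [norm_radial]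
    calc ρ ‖x‖ < ρ 1 := ρ.strictMono hx
      _ = 9 := by rw [hρ 1 le_rfl]; norm_num
  · intro j x hx
    have hj : (0 : ℝ) ≤ j := j.cast_nonneg
    exact radial_congr _ _ (by rw [hσ1 j _ hx.1 hx.2, hρ _ (by linarith [hx.1])])
  · intro x hx
    refine radial_eq_self _ (hσ2 _ (norm_nonneg _) fun j hj => ?_)
    by_contra hcon
    exact hx ⟨j, hj, not_lt.1 hcon⟩
  · intro j x h1 h2
    rw [norm_radial]
    exact hπ j _ h1 h2

namespace Gears

variable {U T τ : E ≃ₜ E} (hg : Gears U T τ)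

include hg

lemma UU_mem {j : ℕ} {x : E} (hx : x ∈ xShell E j) : U (U x) ∈ xShell E (j + 1) := by
  have hj : (0 : ℝ) ≤ j := j.cast_nonneg
  obtain ⟨h1, h2⟩ := hx
  have h3 := hg.norm_U x (by linarith)
  have h4 := hg.norm_U (U x) (by linarith)
  constructor <;> rw [h4, h3] <;> push_cast <;> linarith

lemma of_UU_mem {j : ℕ} {x : E} (hx : U (U x) ∈ xShell E j) :
    (j = 0 ∧ ∀ i, x ∉ xShell E i) ∨ ∃ i, j = i + 1 ∧ x ∈ xShell E i := by
  have hj : (0 : ℝ) ≤ j := j.cast_nonneg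
  obtain ⟨h1, h2⟩ := hx
  rcases lt_or_ge ‖x‖ 1 with h | h
  · left
    have h3 := hg.norm_U_lt x h
    have h4 : ‖U (U x)‖ < 17 := by
      rcases lt_or_ge ‖U x‖ 1 with h' | h'
      · linarith [hg.norm_U_lt _ h']
      · linarith [hg.norm_U _ h']
    have h5 : (j : ℝ) < 1 := by linarith
    refine ⟨by exact_mod_cast Nat.lt_one_iff.1 (by exact_mod_cast h5), fun i hi => ?_⟩
    have := hi.1
    have hi : (0 : ℝ) ≤ i := i.cast_nonneg
    linarith
  · right
    have h3 := hg.norm_U x h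
    have h4 := hg.norm_U (U x) (by linarith)
    rcases j with _ | i
    · push_cast at h2
      linarith
    · refine ⟨i, rfl, ?_, ?_⟩ <;> push_cast at h1 h2 <;> linarith

/-- The solution of `a = G · U² a U⁻²` for a homeomorphism `G` supported in the shells. -/
theorem exists_infinite_product [NormedSpace ℝ E] [Nontrivial E] {G : E ≃ₜ E} {J : ℕ}
    (hG : ∀ x, (∀ i, J ≤ i → x ∉ xShell E i) → G x = x) :
    ∃ a : ℕ → E ≃ₜ E, (∀ j, IdOff (a j) (xShell E j)) ∧ (∀ j < J, a j = 1) ∧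
      ∃ A : E ≃ₜ E, (∀ j, ∀ x ∈ xShell E j, A x = a j x) ∧
        (∀ x, (∀ j, x ∉ xShell E j) → A x = x) ∧ G * (U * U * A * U⁻¹ * U⁻¹) = A := by
  choose f hf1 hf2 using exists_restrict_xShell (G := G) fun x hx => hG x fun i _ => hx i
  have hfJ : ∀ j < J, f j = 1 := by
    intro j hj
    ext x
    by_cases hx : x ∈ xShell E j
    · rw [hf2 j x hx, hG x, one_app]
      intro i hi hxi
      have := xShell_index_eq hxi (j := j) (by linarith [hx.1]) (by linarith [hx.2])
      omega
    · exact hf1 j x hx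
  let a : ℕ → E ≃ₜ E := fun j => Nat.rec (f 0) (fun j b => f (j + 1) * (U * U * b * (U * U)⁻¹)) j
  have ha : ∀ j, a (j + 1) = f (j + 1) * (U * U * a j * (U * U)⁻¹) := fun j => rfl
  have haoff : ∀ j, IdOff (a j) (xShell E j) := by
    intro j
    induction j with
    | zero => exact hf1 0
    | succ j ih =>
      rw [ha]
      refine (hf1 _).mul ((ih.conj _).mono ?_)
      rintro _ ⟨x, hx, rfl⟩
      exact hg.UU_mem hx
  have haJ : ∀ j < J, a j = 1 := by
    intro j
    induction j with
    | zero => exact hfJ 0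
    | succ j ih =>
      intro hj
      rw [ha, ih (by omega), hfJ _ hj]
      group
  obtain ⟨A, hA1, hA2⟩ := exists_glue_xShell a haoff
  refine ⟨a, haoff, haJ, A, hA1, hA2, ?_⟩
  ext x
  obtain ⟨y, rfl⟩ : ∃ y, U (U y) = x := ⟨U⁻¹ (U⁻¹ x), by rw [app_inv_self, app_inv_self]⟩
  simp only [mul_app, inv_app_self]
  by_cases hx : ∃ j, U (U y) ∈ xShell E j
  · obtain ⟨j, hj⟩ := hx
    rw [hA1 j _ hj]
    rcases hg.of_UU_mem hj with ⟨rfl, hy⟩ | ⟨i, rfl, hi⟩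
    · rw [hA2 y hy, ← hf2 0 _ hj]
      rfl
    · rw [hA1 i y hi, ha, ← hf2 (i + 1) _ (hg.UU_mem ((haoff i).mem hi))]
      simp only [mul_app, mul_inv_rev, inv_app_self]
  · push Not at hx
    have hy : ∀ j, y ∉ xShell E j := fun j hj => hx _ (hg.UU_mem hj)
    rw [hA2 y hy, hA2 _ hx, hG _ fun i _ => hx i]

lemma norm_pow_τ {j : ℕ} {x : E} (h1 : 16 * (j : ℝ) + 1 ≤ ‖x‖) (h2 : ‖x‖ < 16 * j + 16) (k : ℕ) :
    16 * (j : ℝ) + 15 < ‖(τ ^ (k + 1)) x‖ ∧ ‖(τ ^ (k + 1)) x‖ < 16 * j + 16 := by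
  induction k with
  | zero => simpa using hg.norm_τ j x h1 h2
  | succ k ih =>
    rw [pow_succ', mul_app]
    exact hg.norm_τ j _ (by linarith [ih.1]) ih.2

lemma pow_τ_notMem_zone {x : E} (hx : x ∈ zone E) (k : ℕ) : (τ ^ (k + 1)) x ∉ zone E := by
  obtain ⟨j, h1, h2⟩ := hx
  rintro ⟨i, h3, h4⟩
  obtain ⟨h5, h6⟩ := hg.norm_pow_τ h1 (by linarith) k
  have h7 : (i : ℝ) < j + 1 := by linarith
  have h8 : (j : ℝ) < i := by linarith
  have h9 : i < j + 1 := by exact_mod_cast h7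
  have h10 : j < i := by exact_mod_cast h8
  omega

lemma eq_of_pow_τ_eq {x y : E} (hx : x ∈ zone E) (hy : y ∈ zone E) {m n : ℕ}
    (h : (τ ^ m) x = (τ ^ n) y) : m = n ∧ x = y := by
  have key : ∀ {x y : E}, x ∈ zone E → y ∈ zone E → ∀ m k : ℕ, (τ ^ m) x ≠ (τ ^ (m + (k + 1))) y := by
    intro x y hx hy m k h
    rw [pow_add, mul_app] at h
    exact hg.pow_τ_notMem_zone hy k ((τ ^ m).injective h ▸ hx)
  rcases lt_trichotomy m n with hmn | rfl | hmn
  · obtain ⟨k, rfl⟩ := Nat.exists_eq_add_of_lt hmn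
    exact absurd h (key hx hy m k)
  · exact ⟨rfl, (τ ^ m).injective h⟩
  · obtain ⟨k, rfl⟩ := Nat.exists_eq_add_of_lt hmn
    exact absurd h.symm (key hy hx n k)

/-- All members of a sequence of homeomorphisms supported in shells moving slowly to infinity are
short words in four homeomorphisms. -/
theorem exists_compression [NormedSpace ℝ E] [Nontrivial E] (G : ℕ → E ≃ₜ E)
    (hG : ∀ n x, (∀ i, n / 4 ≤ i → x ∉ xShell E i) → G n x = x) :
    ∃ F : E ≃ₜ E, ∀ n, G n = (τ⁻¹ ^ n * F * τ ^ n * T * τ⁻¹ ^ n * F⁻¹ * τ ^ n * T⁻¹) *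
      (U * (τ⁻¹ ^ n * F * τ ^ n * T * τ⁻¹ ^ n * F⁻¹ * τ ^ n * T⁻¹) * U⁻¹) := by
  choose a ha1 ha2 A hA1 hA2 hA3 using fun n => hg.exists_infinite_product (hG n)
  classical
  let C : ℕ × ℕ → Set E := fun p => if p.1 / 4 ≤ p.2 then (τ ^ p.1) '' xShell E p.2 else ∅
  have hC : ∀ p x, x ∈ C p → p.1 / 4 ≤ p.2 ∧ ∃ y ∈ xShell E p.2, (τ ^ p.1) y = x := by
    intro p x hx
    simp only [C] at hx
    split_ifs at hx with h
    · exact ⟨h, hx⟩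
    · exact absurd hx (notMem_empty x)
  have hCclosed : ∀ p, IsClosed (C p) := fun p => by
    simp only [C]
    split_ifs
    · exact (τ ^ p.1).isClosedMap _ (isClosed_xShell _)
    · exact isClosed_empty
  have hCdisj : ∀ p q x, x ∈ C p → x ∈ C q → p = q := fun p q x hp hq => by
    obtain ⟨-, y, hy, hyx⟩ := hC p x hp
    obtain ⟨-, z, hz, hzx⟩ := hC q x hq
    obtain ⟨h1, rfl⟩ := hg.eq_of_pow_τ_eq (xShell_subset_zone _ hy) (xShell_subset_zone _ hz)
      (hyx.trans hzx.symm)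
    exact Prod.ext h1 (xShell_index_eq hy (by linarith [hz.1]) (by linarith [hz.2]))
  have hClf : LocallyFinite C := by
    refine locallyFinite_of_block C Prod.snd (fun p x hx => ?_) fun n => ?_
    · obtain ⟨-, y, hy, rfl⟩ := hC p x hx
      rcases hp : p.1 with _ | k
      · rw [pow_zero, one_app]
        linarith [hy.1]
      · linarith [(hg.norm_pow_τ (j := p.2) (x := y) (by linarith [hy.1]) (by linarith [hy.2]) k).1]
    · refine (((Set.finite_le_nat (4 * n + 3)).prod (Set.finite_le_nat n)).subset ?_)
      rintro p ⟨h1, x, hx⟩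
      have := (hC p x hx).1
      exact ⟨show p.1 ≤ 4 * n + 3 by omega, h1⟩
  have hCoff : ∀ p, IdOff (τ ^ p.1 * a p.1 p.2 * (τ ^ p.1)⁻¹) (C p) := fun p => by
    simp only [C]
    split_ifs with h
    · exact (ha1 p.1 p.2).conj _
    · rw [ha2 p.1 p.2 (not_le.1 h)]
      intro x _
      simp
  obtain ⟨F, hF1, hF2⟩ := exists_glue C hCclosed hCdisj hClf _ hCoff
  refine ⟨F, fun n => ?_⟩
  set B : E ≃ₜ E := τ⁻¹ ^ n * F * τ ^ n with hB
  have hBA : ∀ x ∈ zone E, B x = A n x := by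
    intro x hx
    by_cases hxn : ∃ p, (τ ^ n) x ∈ C p
    · obtain ⟨⟨m, j⟩, hp⟩ := hxn
      obtain ⟨-, y, hy, hyx⟩ := hC _ _ hp
      obtain ⟨h1, rfl⟩ := hg.eq_of_pow_τ_eq (xShell_subset_zone _ hy) hx hyx
      simp only at h1 hy
      subst h1
      rw [hB, mul_app, mul_app, hF1 _ _ hp, hA1 m j _ hy]
      simp only [mul_app, inv_app_self, inv_pow]
    · push Not at hxn
      have h1 : B x = x := by
        rw [hB, mul_app, mul_app, hF2 _ hxn, inv_pow, inv_app_self]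
      rw [h1]
      by_cases hx' : ∃ j, x ∈ xShell E j
      · obtain ⟨j, hj⟩ := hx'
        rw [hA1 n j x hj, ha2 n j, one_app]
        by_contra hcon
        refine hxn (n, j) ?_
        simp only [C]
        rw [if_pos (not_lt.1 hcon)]
        exact ⟨x, hj, rfl⟩
      · push Not at hx'
        exact (hA2 n x hx').symm
  have hAzone : IdOff (A n) (zone E) := fun x hx =>
    hA2 n x fun j hj => hx (xShell_subset_zone j hj)
  have hT : IdOff T (zone E) := hg.T_eq_self
  have hcomm : T * ((A n)⁻¹ * B) = (A n)⁻¹ * B * T := hT.mul_comm fun x hx => by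
    rw [mul_app, hBA x hx, inv_app_self]
  have hcomm1 : B * T * B⁻¹ = A n * T * (A n)⁻¹ := by
    calc B * T * B⁻¹ = A n * ((A n)⁻¹ * B * T) * B⁻¹ := by group
      _ = A n * (T * ((A n)⁻¹ * B)) * B⁻¹ := by rw [hcomm]
      _ = A n * T * (A n)⁻¹ := by group
  have hAshell : IdOff (A n)⁻¹ (⋃ j, xShell E j) :=
    IdOff.inv fun x hx => hA2 n x (by simpa using hx)
  have hTU : T * (A n)⁻¹ * T⁻¹ = U * (A n)⁻¹ * U⁻¹ := by
    have h : (A n)⁻¹ * (U⁻¹ * T) = U⁻¹ * T * (A n)⁻¹ := hAshell.mul_comm fun x hx => by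
      obtain ⟨j, hj⟩ := mem_iUnion.1 hx
      rw [mul_app, hg.T_eq_U j x hj, inv_app_self]
    calc T * (A n)⁻¹ * T⁻¹ = U * (U⁻¹ * T * (A n)⁻¹) * T⁻¹ := by group
      _ = U * ((A n)⁻¹ * (U⁻¹ * T)) * T⁻¹ := by rw [h]
      _ = U * (A n)⁻¹ * U⁻¹ := by group
  have hE : τ⁻¹ ^ n * F * τ ^ n * T * τ⁻¹ ^ n * F⁻¹ * τ ^ n * T⁻¹ = A n * (U * (A n)⁻¹ * U⁻¹) := by
    calc τ⁻¹ ^ n * F * τ ^ n * T * τ⁻¹ ^ n * F⁻¹ * τ ^ n * T⁻¹ = B * T * B⁻¹ * T⁻¹ := by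
          rw [hB]; group
      _ = A n * (T * (A n)⁻¹ * T⁻¹) := by rw [hcomm1]; group
      _ = _ := by rw [hTU]
  rw [hE]
  calc G n = G n * (U * U * A n * U⁻¹ * U⁻¹) * (U * U * (A n)⁻¹ * U⁻¹ * U⁻¹) := by group
    _ = A n * (U * U * (A n)⁻¹ * U⁻¹ * U⁻¹) := by rw [hA3]
    _ = _ := by group

end Gears

end Compressor

section Words

variable {G : Type*} [Group G]

/-- `g` is a product of at most `k` elements of `S` and their inverses. -/
def Word (S : Set G) (k : ℕ) (g : G) : Prop :=
  ∃ L : List G, L.length ≤ k ∧ (∀ x ∈ L, x ∈ S ∨ x⁻¹ ∈ S) ∧ g = L.prod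

namespace Word

variable {S : Set G} {k l : ℕ} {g g' : G}

lemma of_mem (h : g ∈ S) : Word S 1 g := ⟨[g], by simp, by simp [h], by simp⟩

lemma of_inv_mem (h : g ∈ S) : Word S 1 g⁻¹ := ⟨[g⁻¹], by simp, by simp [h], by simp⟩

lemma mul (h : Word S k g) (h' : Word S l g') : Word S (k + l) (g * g') := by
  obtain ⟨L, h1, h2, h3⟩ := h
  obtain ⟨L', h1', h2', h3'⟩ := h'
  refine ⟨L ++ L', by rw [List.length_append]; omega, fun x hx => ?_, by simp [h3, h3']⟩
  rcases List.mem_append.1 hx with hx | hx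
  exacts [h2 x hx, h2' x hx]

lemma one : Word S 0 (1 : G) := ⟨[], by simp, by simp, by simp⟩

lemma pow (h : Word S 1 g) (n : ℕ) : Word S n (g ^ n) := by
  induction n with
  | zero => simpa using one
  | succ n ih => rw [pow_succ]; exact ih.mul h

lemma mono {S' : Set G} (h : Word S k g) (hS : S ⊆ S') (hk : k ≤ l) : Word S' l g := by
  obtain ⟨L, h1, h2, h3⟩ := h
  exact ⟨L, h1.trans hk, fun x hx => (h2 x hx).imp (fun h => hS h) fun h => hS h, h3⟩

lemma map {H : Type*} [Group H] (φ : G →* H) (h : Word S k g) : Word (φ '' S) k (φ g) := by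
  obtain ⟨L, h1, h2, rfl⟩ := h
  refine ⟨L.map φ, by rwa [List.length_map], fun x hx => ?_, map_list_prod φ L⟩
  obtain ⟨y, hy, rfl⟩ := List.mem_map.1 hx
  exact (h2 y hy).imp (fun h => ⟨y, h, rfl⟩) fun h => ⟨y⁻¹, h, by simp⟩

end Word

end Words

section Decomposition

variable {E : Type*} [NormedAddCommGroup E]

/-- `f` can be continued from the ball of radius `r` by the identity off the ball of radius `R`. -/
def Continuable (f : E ≃ₜ E) (r R : ℝ) : Prop :=
  ∃ g : E ≃ₜ E, (∀ x, ‖x‖ ≤ r → g x = f x) ∧ ∀ x, R ≤ ‖x‖ → g x = x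

/-- `f` agrees on each ball with a compactly supported homeomorphism. -/
def IsTame (f : E ≃ₜ E) : Prop := ∀ r, ∃ R, Continuable f r R

lemma Continuable.mono {f : E ≃ₜ E} {r R R' : ℝ} (h : Continuable f r R) (hR : R ≤ R') :
    Continuable f r R' := by
  obtain ⟨g, h1, h2⟩ := h
  exact ⟨g, h1, fun x hx => h2 x (hR.trans hx)⟩

lemma Continuable.norm_le {f : E ≃ₜ E} {r R : ℝ} (h : Continuable f r R) {x : E} (hx : ‖x‖ ≤ r) :
    ‖f x‖ ≤ max r R := by
  obtain ⟨g, h1, h2⟩ := h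
  rw [← h1 x hx]
  by_contra hcon
  obtain ⟨h3, h4⟩ := max_lt_iff.1 (not_le.1 hcon)
  rw [g.injective (h2 _ h4.le)] at h3
  linarith

/-- `f` behaves well with respect to integral radii starting from `16 J`. -/
structure Normalized (f : E ≃ₜ E) (J : ℕ) : Prop where
  cont : ∀ k : ℕ, 16 * J ≤ k → Continuable f k (k + 1)
  inv_le : ∀ k : ℕ, 16 * J ≤ k → ∀ x, ‖x‖ ≤ k → ‖f⁻¹ x‖ ≤ k + 1

lemma exists_profile_squeeze : ∃ ρ : ℝ ≃o ℝ, ρ 0 = 0 ∧ ∀ j : ℕ, ∀ t : ℝ,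
    16 * j + 5 ≤ t → t ≤ 16 * j + 20 → 16 * j + 18 ≤ ρ t ∧ ρ t ≤ 16 * j + 22 := by
  let u : ℕ → ℝ := fun k => if k < 5 then (k : ℝ) else
    16 * ((k - 5) / 16 : ℕ) + 18 + 4 * ((k - 5) % 16 : ℕ) / 15
  have hu : ∀ j i : ℕ, i < 16 → u (16 * j + i + 5) = 16 * j + 18 + 4 * i / 15 := by
    intro j i hi
    simp only [u]
    rw [if_neg (by omega), show (16 * j + i + 5 - 5) / 16 = j by omega,
      show (16 * j + i + 5 - 5) % 16 = i by omega]
  have hmono : StrictMono u := strictMono_nat_of_lt_succ fun k => by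
    rcases lt_or_ge k 5 with hk | hk
    · interval_cases k <;> norm_num [u]
    obtain ⟨j, i, hi, rfl⟩ : ∃ j i : ℕ, i < 16 ∧ k = 16 * j + i + 5 :=
      ⟨(k - 5) / 16, (k - 5) % 16, Nat.mod_lt _ (by norm_num), by omega⟩
    rw [hu j i hi]
    rcases Nat.lt_or_ge i 15 with hi' | hi'
    · have := hu j (i + 1) (by omega)
      rw [show 16 * j + i + 5 + 1 = 16 * j + (i + 1) + 5 by ring, this]
      push_cast
      linarith
    · obtain rfl : i = 15 := by omega
      have := hu (j + 1) 0 (by omega)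
      rw [show 16 * j + 15 + 5 + 1 = 16 * (j + 1) + 0 + 5 by ring, this]
      push_cast
      linarith
  obtain ⟨ρ, h0, hρ⟩ := exists_orderIso_interpolating u hmono (by simp [u]) (fun M => by
    obtain ⟨k, hk⟩ := exists_nat_gt M
    refine ⟨16 * k + 0 + 5, ?_⟩
    rw [hu k 0 (by norm_num)]
    have : (0 : ℝ) ≤ k := k.cast_nonneg
    push_cast
    linarith)
  have hρ' : ∀ k : ℕ, ρ k = u k := fun k => by
    rw [hρ k k le_rfl (by linarith)]
    ring
  refine ⟨ρ, h0, fun j t h1 h2 => ?_⟩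
  have h3 := hρ' (16 * j + 0 + 5)
  have h4 := hρ' (16 * j + 15 + 5)
  rw [hu j 0 (by norm_num)] at h3
  rw [hu j 15 (by norm_num)] at h4
  push_cast at h3 h4
  have h5 := ρ.monotone (show (16 * j + 0 + 5 : ℝ) ≤ t by linarith)
  have h6 := ρ.monotone (show t ≤ (16 * j + 15 + 5 : ℝ) by linarith)
  constructor <;> linarith

variable [NormedSpace ℝ E] [Nontrivial E]

/-- A normalized homeomorphism is a product of three homeomorphisms supported, respectively, in the
shells, in a ball, and in the gaps between the cores of the shells. -/
theorem Normalized.exists_factorization {f : E ≃ₜ E} {J : ℕ} (hf : Normalized f J) :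
    ∃ p q w : E ≃ₜ E, f = p * q * w ∧ (∀ x, (∀ i, J ≤ i → x ∉ xShell E i) → p x = x) ∧
      (∀ x, 16 * (J : ℝ) + 4 ≤ ‖x‖ → q x = x) ∧ (∀ x, ‖x‖ ≤ 16 * (J : ℝ) + 5 → w x = x) ∧
      ∀ j : ℕ, J ≤ j → ∀ x, 16 * (j : ℝ) + 4 ≤ ‖x‖ → ‖x‖ ≤ 16 * (j : ℝ) + 5 → w x = x := by
  have hφ : ∀ j : ℕ, ∃ φ : E ≃ₜ E, IdOff φ (xShell E j) ∧ (j < J → φ = 1) ∧ (J ≤ j → ∀ x,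
      16 * (j : ℝ) + 4 ≤ ‖x‖ → ‖x‖ ≤ 16 * (j : ℝ) + 5 → φ x = f x) := by
    intro j
    rcases lt_or_ge j J with hj | hj
    · exact ⟨1, idOff_one _, fun _ => rfl, fun h => absurd hj (not_lt.2 h)⟩
    obtain ⟨g, hg1, hg2⟩ := hf.cont (16 * j + 5) (by omega)
    obtain ⟨k, hk1, hk2⟩ := hf.cont (16 * j + 3) (by omega)
    have hinv := hf.inv_le (16 * j + 2) (by omega)
    push_cast at hg1 hg2 hk1 hk2 hinv
    have hk3 : ∀ x, 16 * (j : ℝ) + 4 ≤ ‖x‖ → k⁻¹ x = x := fun x hx =>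
      inv_app_eq.2 (hk2 x (by linarith)).symm
    refine ⟨g * k⁻¹, fun x hx => ?_, fun h => absurd hj (not_le.2 h), fun _ x h1 h2 => ?_⟩
    · rw [mul_app]
      rcases le_or_gt ‖x‖ (16 * (j : ℝ) + 2) with h | h
      · have h3 := hinv x h
        have h4 : k⁻¹ x = f⁻¹ x := inv_app_eq.2 (by
          rw [hk1 _ (by linarith), app_inv_self])
        rw [h4, hg1 _ (by linarith), app_inv_self]
      · have h3 : 16 * (j : ℝ) + 6 < ‖x‖ := by
          by_contra hcon
          exact hx ⟨h.le, not_lt.1 hcon⟩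
        rw [hk3 x (by linarith), hg2 x (by linarith)]
    · rw [mul_app, hk3 x h1, hg1 x h2]
  choose φ hφ1 hφ2 hφ3 using hφ
  obtain ⟨p, hp1, hp2⟩ := exists_glue_xShell φ hφ1
  have hu : ∀ j : ℕ, J ≤ j → ∀ x, 16 * (j : ℝ) + 4 ≤ ‖x‖ → ‖x‖ ≤ 16 * (j : ℝ) + 5 →
      (p⁻¹ * f) x = x := fun j hj x h1 h2 => by
    rw [mul_app, inv_app_eq, hp1 j x ⟨by linarith, by linarith⟩, hφ3 j hj x h1 h2]
  obtain ⟨q, hq1, hq2⟩ := exists_cut (by linarith) (hu J le_rfl)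
  refine ⟨p, q, q⁻¹ * (p⁻¹ * f), by group, fun x hx => ?_, hq2, fun x hx => ?_,
    fun j hj x h1 h2 => ?_⟩
  · by_cases h : ∃ i, x ∈ xShell E i
    · obtain ⟨i, hi⟩ := h
      rw [hp1 i x hi, hφ2 i (not_le.1 fun h => hx i h hi), one_app]
    · exact hp2 x (by simpa using h)
  · rw [mul_app, ← hq1 x hx, inv_app_self]
  · rw [mul_app, hu j hj x h1 h2, inv_app_eq, hq2]
    have : (J : ℝ) ≤ j := by exact_mod_cast hj
    linarith

/-- A squeeze of the gaps between cores into shells. -/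
def Squeeze (κ : E ≃ₜ E) : Prop := ∀ (w : E ≃ₜ E) (J : ℕ),
  (∀ x, ‖x‖ ≤ 16 * (J : ℝ) + 5 → w x = x) → (∀ j : ℕ, J ≤ j → ∀ x, 16 * (j : ℝ) + 4 ≤ ‖x‖ →
    ‖x‖ ≤ 16 * (j : ℝ) + 5 → w x = x) →
    ∀ x, (∀ i, J ≤ i → x ∉ xShell E i) → (κ * w * κ⁻¹) x = x

omit [Nontrivial E] in
theorem exists_squeeze : ∃ κ : E ≃ₜ E, Squeeze κ := by
  obtain ⟨ρ, h0, hρ⟩ := exists_profile_squeeze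
  refine ⟨radial ρ h0, fun w J hw1 hw2 x hx => ?_⟩
  obtain ⟨y, rfl⟩ : ∃ y, radial ρ h0 y = x := ⟨(radial ρ h0)⁻¹ x, app_inv_self _ _⟩
  rw [mul_app, mul_app, inv_app_self]
  congr 1
  rcases le_or_gt ‖y‖ (16 * (J : ℝ) + 5) with h | h
  · exact hw1 y h
  have hJ : (0 : ℝ) ≤ J := J.cast_nonneg
  obtain ⟨j, i, hi, h1, h2⟩ := exists_block (t := ‖y‖ - 5) (by linarith)
  have hi' : (i : ℝ) + 1 ≤ 16 := by exact_mod_cast hi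
  have hi0 : (0 : ℝ) ≤ i := i.cast_nonneg
  have hJj : J ≤ j := by
    have : (J : ℝ) < j + 1 := by linarith
    exact Nat.lt_succ_iff.1 (by exact_mod_cast this)
  rcases le_or_gt ‖y‖ (16 * (j : ℝ) + 20) with h3 | h3
  · obtain ⟨h4, h5⟩ := hρ j ‖y‖ (by linarith) h3
    refine absurd ?_ (hx (j + 1) (by omega))
    constructor <;> rw [norm_radial] <;> push_cast <;> linarith
  · refine hw2 (j + 1) (by omega) y ?_ ?_ <;> push_cast <;> linarith

/-- A homothety moving a ball into a shell. -/
theorem exists_homothety : ∃ θ : E ≃ₜ E, ∀ x : E, ‖x‖ < 5 → 3 < ‖θ x‖ ∧ ‖θ x‖ < 5 := by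
  obtain ⟨e, he⟩ := exists_norm_eq E (show (0 : ℝ) ≤ 4 by norm_num)
  refine ⟨mkHomeo (fun x => (1 / 5 : ℝ) • x + e) (fun x => (5 : ℝ) • (x - e)) (by fun_prop)
    (by fun_prop) (fun x => ?_) (fun x => ?_), fun x hx => ?_⟩
  · simp [smul_smul]
  · simp [smul_smul]
  · change 3 < ‖(1 / 5 : ℝ) • x + e‖ ∧ ‖(1 / 5 : ℝ) • x + e‖ < 5
    have h1 : ‖(1 / 5 : ℝ) • x‖ < 1 := by
      rw [norm_smul, Real.norm_eq_abs, abs_of_pos (by norm_num)]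
      linarith
    have h2 := norm_add_le ((1 / 5 : ℝ) • x) e
    have h3 := norm_sub_norm_le e (-((1 / 5 : ℝ) • x))
    rw [sub_neg_eq_add, norm_neg, add_comm e] at h3
    constructor <;> linarith

omit [Nontrivial E] [NormedSpace ℝ E] in
lemma Gears.norm_UU_pow {U T τ : E ≃ₜ E} (hg : Gears U T τ) (n : ℕ) {x : E} (hx : 1 ≤ ‖x‖) :
    ‖(U ^ n) x‖ = ‖x‖ + 8 * n := by
  induction n with
  | zero => simp
  | succ n ih =>
    rw [pow_succ', mul_app, hg.norm_U _ (by rw [ih]; have : (0:ℝ) ≤ n := n.cast_nonneg; linarith), ih]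
    push_cast
    ring

omit [Nontrivial E] [NormedSpace ℝ E] in
lemma Gears.conj_homothety {U T τ θ : E ≃ₜ E} (hg : Gears U T τ)
    (hθ : ∀ x : E, ‖x‖ < 5 → 3 < ‖θ x‖ ∧ ‖θ x‖ < 5) {q : E ≃ₜ E} {J : ℕ}
    (hq : ∀ x, 16 * (J : ℝ) + 4 ≤ ‖x‖ → q x = x) (x : E) (hx : ∀ i, J ≤ i → x ∉ xShell E i) :
    (U ^ (2 * J) * θ * U⁻¹ ^ (2 * J) * q * (U ^ (2 * J) * θ * U⁻¹ ^ (2 * J))⁻¹) x = x := by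
  obtain ⟨y, rfl⟩ : ∃ y, (U ^ (2 * J) * θ) y = x :=
    ⟨(U ^ (2 * J) * θ)⁻¹ x, app_inv_self _ _⟩
  rcases lt_or_ge ‖y‖ 5 with h | h
  · obtain ⟨h1, h2⟩ := hθ y h
    have h3 := hg.norm_UU_pow (2 * J) (x := θ y) (by linarith)
    refine absurd ?_ (hx J le_rfl)
    push_cast at h3
    constructor <;> rw [mul_app, h3] <;> linarith
  · have h3 := hg.norm_UU_pow (2 * J) (x := y) (by linarith)
    have h4 : q ((U ^ (2 * J)) y) = (U ^ (2 * J)) y := hq _ (by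
      rw [h3]; push_cast; linarith)
    simp only [mul_app, mul_inv_rev, inv_pow, inv_app_self, inv_inv, h4]

/-- A normalized sequence of homeomorphisms consists of short words in eight generators. -/
theorem exists_words_of_normalized (h : ℕ → E ≃ₜ E) (hn : ∀ n, Normalized (h n) (n / 4)) :
    ∃ U T τ κ θ F₁ F₂ F₃ : E ≃ₜ E, ∀ n,
      Word {U, T, τ, κ, θ, F₁, F₂, F₃} (26 * n + 34) (h n) := by
  obtain ⟨U, T, τ, hg⟩ := exists_gears (E := E)
  obtain ⟨κ, hκ⟩ := exists_squeeze (E := E)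
  obtain ⟨θ, hθ⟩ := exists_homothety (E := E)
  choose p q w hpqw hp hq hw1 hw2 using fun n => (hn n).exists_factorization
  obtain ⟨F₁, hF₁⟩ := hg.exists_compression p hp
  obtain ⟨F₂, hF₂⟩ := hg.exists_compression _ fun n => hg.conj_homothety hθ (hq n)
  obtain ⟨F₃, hF₃⟩ := hg.exists_compression _ fun n => hκ (w n) (n / 4) (hw1 n) (hw2 n)
  refine ⟨U, T, τ, κ, θ, F₁, F₂, F₃, fun n => ?_⟩
  set S : Set (E ≃ₜ E) := {U, T, τ, κ, θ, F₁, F₂, F₃}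
  have hU : U ∈ S := by simp [S]
  have hT : T ∈ S := by simp [S]
  have hτ : τ ∈ S := by simp [S]
  have hκ : κ ∈ S := by simp [S]
  have hθ : θ ∈ S := by simp [S]
  have key : ∀ F ∈ S, ∀ g : E ≃ₜ E, g = (τ⁻¹ ^ n * F * τ ^ n * T * τ⁻¹ ^ n * F⁻¹ * τ ^ n * T⁻¹) *
      (U * (τ⁻¹ ^ n * F * τ ^ n * T * τ⁻¹ ^ n * F⁻¹ * τ ^ n * T⁻¹) * U⁻¹) →
      Word S (8 * n + 10) g := by
    rintro F hF _ rfl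
    have h1 : Word S (n + 1 + n + 1 + n + 1 + n + 1)
        (τ⁻¹ ^ n * F * τ ^ n * T * τ⁻¹ ^ n * F⁻¹ * τ ^ n * T⁻¹) :=
      (((((((((Word.of_inv_mem hτ).pow n).mul (.of_mem hF)).mul ((Word.of_mem hτ).pow n)).mul
        (.of_mem hT)).mul ((Word.of_inv_mem hτ).pow n)).mul (.of_inv_mem hF)).mul
        ((Word.of_mem hτ).pow n)).mul (.of_inv_mem hT))
    exact (h1.mul (((Word.of_mem hU).mul h1).mul (.of_inv_mem hU))).mono subset_rfl (by omega)
  have hW₁ := key F₁ (by simp [S]) _ (hF₁ n)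
  have hW₂ := key F₂ (by simp [S]) _ (hF₂ n)
  have hW₃ := key F₃ (by simp [S]) _ (hF₃ n)
  have hV : Word S (2 * (n / 4) + 1 + 2 * (n / 4)) (U ^ (2 * (n / 4)) * θ * U⁻¹ ^ (2 * (n / 4))) :=
    ((Word.of_mem hU).pow _ |>.mul (.of_mem hθ)).mul ((Word.of_inv_mem hU).pow _)
  have hV' : Word S (2 * (n / 4) + 1 + 2 * (n / 4))
      (U ^ (2 * (n / 4)) * θ⁻¹ * U⁻¹ ^ (2 * (n / 4))) :=
    ((Word.of_mem hU).pow _ |>.mul (.of_inv_mem hθ)).mul ((Word.of_inv_mem hU).pow _)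
  have hfac : h n = p n *
      ((U ^ (2 * (n / 4)) * θ⁻¹ * U⁻¹ ^ (2 * (n / 4))) *
      (U ^ (2 * (n / 4)) * θ * U⁻¹ ^ (2 * (n / 4)) * q n *
        (U ^ (2 * (n / 4)) * θ * U⁻¹ ^ (2 * (n / 4)))⁻¹) *
      (U ^ (2 * (n / 4)) * θ * U⁻¹ ^ (2 * (n / 4)))) * (κ⁻¹ * (κ * w n * κ⁻¹) * κ) := by
    rw [hpqw n]
    group
  rw [hfac]
  exact ((hW₁.mul ((hV'.mul hW₂).mul hV)).mul (((Word.of_inv_mem hκ).mul hW₃).mul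
    (.of_mem hκ))).mono subset_rfl (by omega)

omit [Nontrivial E] in
/-- A sequence of tame homeomorphisms can be normalized by a radial conjugation. -/
theorem exists_normalization (h : ℕ → E ≃ₜ E) (ht : ∀ n, IsTame (h n)) (ht' : ∀ n, IsTame (h n)⁻¹) :
    ∃ N : E ≃ₜ E, ∀ n, Normalized (N⁻¹ * h n * N) (n / 4) := by
  have hstep : ∀ (k : ℕ) (r : ℝ), ∃ R, r + 1 ≤ R ∧ ∀ m < k + 4, Continuable (h m) r R ∧
      ∀ x, ‖x‖ ≤ r → ‖(h m)⁻¹ x‖ ≤ R := by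
    intro k r
    choose R₁ hR₁ using fun m => ht m r
    choose R₂ hR₂ using fun m => ht' m r
    have hnn : ∀ m, 0 ≤ |R₁ m| + |R₂ m| := fun m => by positivity
    refine ⟨|r| + 1 + ∑ m ∈ Finset.range (k + 4), (|R₁ m| + |R₂ m|), ?_, fun m hm => ?_⟩
    · linarith [le_abs_self r, Finset.sum_nonneg fun m (_ : m ∈ Finset.range (k + 4)) => hnn m]
    · have h1 := Finset.single_le_sum (fun i _ => hnn i) (Finset.mem_range.2 hm)
      have h2 := le_abs_self (R₁ m)
      have h3 := le_abs_self (R₂ m)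
      have h4 := abs_nonneg (R₁ m)
      have h5 := abs_nonneg (R₂ m)
      have h6 := le_abs_self r
      have h7 := abs_nonneg r
      refine ⟨(hR₁ m).mono (by linarith), fun x hx => ((hR₂ m).norm_le hx).trans (max_le ?_ ?_)⟩ <;>
      linarith
  choose s hs1 hs2 using hstep
  let R : ℕ → ℝ := fun k => Nat.rec 0 (fun k r => s k r) k
  have hR : ∀ k, R (k + 1) = s k (R k) := fun k => rfl
  have hRk : ∀ k : ℕ, (k : ℝ) ≤ R k := by
    intro k
    induction k with
    | zero => simp [R]
    | succ k ih =>
      rw [hR]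
      push_cast
      linarith [hs1 k (R k)]
  obtain ⟨ρ, h0, hρ⟩ := exists_orderIso_interpolating R
    (strictMono_nat_of_lt_succ fun k => by rw [hR]; linarith [hs1 k (R k)]) rfl (fun M => by
      obtain ⟨k, hk⟩ := exists_nat_gt M
      exact ⟨k, hk.trans_le (hRk k)⟩)
  have hρ' : ∀ k : ℕ, ρ k = R k := fun k => by
    rw [hρ k k le_rfl (by linarith)]
    ring
  have hρ1 : ∀ k : ℕ, ρ (k + 1) = s k (R k) := fun k => by
    have := hρ' (k + 1)
    push_cast at this
    rw [this, hR]
  have hN : ∀ (x : E) (k : ℕ), ‖x‖ ≤ k → ‖radial ρ h0 x‖ ≤ R k := fun x k hx => by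
    rw [norm_radial, ← hρ']
    exact ρ.monotone hx
  refine ⟨radial ρ h0, fun n => ⟨fun k hk => ?_, fun k hk x hx => ?_⟩⟩
  · obtain ⟨g, hg1, hg2⟩ := (hs2 k (R k) n (by omega)).1
    refine ⟨(radial ρ h0)⁻¹ * g * radial ρ h0, fun x hx => ?_, fun x hx => ?_⟩
    · simp only [mul_app]
      rw [hg1 _ (hN x k hx)]
    · simp only [mul_app]
      rw [hg2, inv_app_self]
      rw [norm_radial, ← hρ1]
      exact ρ.monotone hx
  · simp only [mul_inv_rev, inv_inv, mul_app]
    rw [norm_radial_inv, ρ.symm_apply_le, hρ1]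
    exact (hs2 k (R k) n (by omega)).2 _ (hN x k hx)

/-- Strong distortion for sequences of tame homeomorphisms. -/
theorem exists_words_of_tame (h : ℕ → E ≃ₜ E) (ht : ∀ n, IsTame (h n))
    (ht' : ∀ n, IsTame (h n)⁻¹) :
    ∃ S : Set (E ≃ₜ E), S.Finite ∧ S.ncard ≤ 9 ∧ ∀ n, Word S (26 * n + 12) (h n) := by
  obtain ⟨N, hN⟩ := exists_normalization (fun n => h (n + 1)) (fun n => ht _) fun n => ht' _
  obtain ⟨U, T, τ, κ, θ, F₁, F₂, F₃, hW⟩ := exists_words_of_normalized _ hN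
  classical
  set S₀ : Finset (E ≃ₜ E) := {U, T, τ, κ, θ, F₁, F₂, F₃} with hS₀
  have hcard : S₀.card ≤ 8 := by
    rw [hS₀]
    exact (Finset.card_insert_le _ _).trans (Nat.succ_le_succ ((Finset.card_insert_le _ _).trans
      (Nat.succ_le_succ Finset.card_le_six)))
  have hcoe : (S₀ : Set (E ≃ₜ E)) = {U, T, τ, κ, θ, F₁, F₂, F₃} := by simp [hS₀]
  rw [← hcoe] at hW
  have hfin : (MulAut.conj N '' (S₀ : Set (E ≃ₜ E))).Finite := S₀.finite_toSet.image _
  refine ⟨insert (h 0) (MulAut.conj N '' S₀), hfin.insert _, ?_, fun n => ?_⟩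
  · refine (Set.ncard_insert_le _ _).trans (Nat.succ_le_succ ?_)
    refine (Set.ncard_image_le S₀.finite_toSet).trans ?_
    rwa [Set.ncard_coe_finset]
  · rcases n with _ | n
    · exact (Word.of_mem (mem_insert _ _)).mono subset_rfl (by omega)
    · have := (hW n).map (MulAut.conj N).toMonoidHom
      have h1 : (MulAut.conj N).toMonoidHom (N⁻¹ * h (n + 1) * N) = h (n + 1) := by
        change N * (N⁻¹ * h (n + 1) * N) * N⁻¹ = h (n + 1)
        group
      rw [h1] at this
      exact this.mono (subset_insert _ _) (by omega)

end Decomposition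

section Tame

variable {E : Type*} [NormedAddCommGroup E]

lemma exists_norm_le_image [ProperSpace E] (f : E ≃ₜ E) (r : ℝ) :
    ∃ R, ∀ x, ‖x‖ ≤ r → ‖f x‖ ≤ R := by
  obtain ⟨R, hR⟩ := ((isCompact_closedBall (0 : E) r).image f.continuous).isBounded.exists_norm_le
  exact ⟨R, fun x hx => hR _ ⟨x, by simpa using hx, rfl⟩⟩

lemma IsTame.mul {f g : E ≃ₜ E} (hf : IsTame f) (hg : IsTame g) : IsTame (f * g) := by
  intro r
  obtain ⟨R₁, h₁⟩ := hg r
  obtain ⟨R₂, h₂⟩ := hf (max r R₁)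
  have h₃ := fun x hx => h₁.norm_le (x := x) hx
  obtain ⟨g', hg1, hg2⟩ := h₁
  obtain ⟨f', hf1, hf2⟩ := h₂
  refine ⟨max R₁ R₂, f' * g', fun x hx => ?_, fun x hx => ?_⟩
  · rw [mul_app, mul_app, hg1 x hx, hf1 _ (h₃ x hx)]
  · rw [mul_app, hg2 x ((le_max_left _ _).trans hx), hf2 x ((le_max_right _ _).trans hx)]

lemma isTame_one : IsTame (1 : E ≃ₜ E) := fun r => ⟨r, 1, fun _ _ => rfl, fun _ _ => rfl⟩

lemma IsTame.inv [ProperSpace E] {f : E ≃ₜ E} (hf : IsTame f) : IsTame f⁻¹ := by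
  intro r
  obtain ⟨r', hr'⟩ := exists_norm_le_image f⁻¹ r
  obtain ⟨R, g, hg1, hg2⟩ := hf r'
  refine ⟨R, g⁻¹, fun x hx => inv_app_eq.2 ?_, fun x hx => inv_app_eq.2 (hg2 x hx).symm⟩
  rw [hg1 _ (hr' x hx), app_inv_self]

lemma IsTame.conj [ProperSpace E] {f : E ≃ₜ E} (hf : IsTame f) (k : E ≃ₜ E) :
    IsTame (k * f * k⁻¹) := by
  intro r
  obtain ⟨r', hr'⟩ := exists_norm_le_image k⁻¹ r
  obtain ⟨R, g, hg1, hg2⟩ := hf r'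
  obtain ⟨R', hR'⟩ := exists_norm_le_image k R
  refine ⟨R' + 1, k * g * k⁻¹, fun x hx => ?_, fun x hx => ?_⟩
  · simp only [mul_app, hg1 _ (hr' x hx)]
  · rw [mul_app, mul_app, hg2, app_inv_self]
    by_contra hcon
    have := hR' _ (not_le.1 hcon).le
    rw [app_inv_self] at this
    linarith

/-- The subgroup of tame homeomorphisms. -/
def tame (E : Type*) [NormedAddCommGroup E] [ProperSpace E] : Subgroup (E ≃ₜ E) where
  carrier := {f | IsTame f}
  mul_mem' := IsTame.mul
  one_mem' := isTame_one
  inv_mem' := IsTame.inv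

instance [ProperSpace E] : (tame E).Normal := ⟨fun _ hf k => IsTame.conj hf k⟩

lemma exists_profile_contraction (r : ℝ) {ε : ℝ} (hε : 0 < ε) :
    ∃ ρ : ℝ ≃o ℝ, ρ 0 = 0 ∧ ρ r ≤ ε ∧ ∃ R, ∀ t, R ≤ t → ρ t = t := by
  obtain ⟨n, hn⟩ := exists_nat_gt (max r (max ε 0))
  obtain ⟨hn1, hn2⟩ := max_lt_iff.1 hn
  obtain ⟨hn3, hn4⟩ := max_lt_iff.1 hn2
  have hd : 0 < ε / n := div_pos hε hn4
  have hd1 : ε / n < 1 := (div_lt_one hn4).2 hn3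
  obtain ⟨ρ, h0, hρ⟩ := exists_orderIso_interpolating
    (fun k => if k ≤ n then k * (ε / n) else (k : ℝ))
    (strictMono_nat_of_lt_succ fun k => by
      have hk : (0 : ℝ) ≤ k := k.cast_nonneg
      push_cast
      split_ifs
      · nlinarith
      · nlinarith
      · omega
      · linarith) (by simp) (fun M => by
      obtain ⟨k, hk⟩ := exists_nat_gt M
      refine ⟨k + (n + 1), ?_⟩
      rw [if_neg (by omega)]
      push_cast
      linarith)
  refine ⟨ρ, h0, ?_, n + 1, fun t ht => ?_⟩
  · calc ρ r ≤ ρ n := ρ.monotone hn1.le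
      _ = ε := by
        rw [hρ n n le_rfl (by linarith), if_pos le_rfl]
        field_simp
        ring
      _ ≤ ε := le_rfl
  · have ht' : n + 1 ≤ ⌊t⌋₊ := Nat.le_floor (by push_cast; exact ht)
    rw [hρ ⌊t⌋₊ t (Nat.floor_le (by linarith)) (Nat.lt_floor_add_one t).le, if_neg (by omega),
      if_neg (by omega)]
    push_cast
    ring

variable [NormedSpace ℝ E] [ProperSpace E]

lemma isTame_of_eqOn_ball {f : E ≃ₜ E} {ε : ℝ} (hε : 0 < ε) (hf : ∀ x, ‖x‖ ≤ ε → f x = x) :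
    IsTame f := by
  intro r
  obtain ⟨ρ, h0, hρ, R, hR⟩ := exists_profile_contraction r hε
  set b : E ≃ₜ E := radial ρ h0
  have hb : ∀ x, R ≤ ‖x‖ → b x = x := fun x hx => radial_eq_self h0 (hR _ hx)
  obtain ⟨R', hR'⟩ := exists_norm_le_image f R
  refine ⟨max R (R' + 1), f * b⁻¹ * f⁻¹ * b, fun x hx => ?_, fun x hx => ?_⟩
  · have h1 : f⁻¹ (b x) = b x := inv_app_eq.2 (hf _ (by
      rw [norm_radial]
      exact (ρ.monotone hx).trans hρ)).symm
    simp only [mul_app, h1, inv_app_self]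
  · obtain ⟨h1, h2⟩ := max_le_iff.1 hx
    have h3 : b⁻¹ (f⁻¹ x) = f⁻¹ x := by
      refine inv_app_eq.2 (hb _ ?_).symm
      by_contra hcon
      have := hR' _ (not_le.1 hcon).le
      rw [app_inv_self] at this
      linarith
    simp only [mul_app, hb x h1, h3, app_inv_self]

theorem mem_tame_of_eventuallyEq_id {f : E ≃ₜ E} {p : E} (hf : ∀ᶠ x in 𝓝 p, f x = x) :
    f ∈ tame E := by
  obtain ⟨ε, hε, hball⟩ := Metric.eventually_nhds_iff.1 hf
  set k : E ≃ₜ E := Homeomorph.addRight p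
  have hk : ∀ x, k x = x + p := fun x => rfl
  have h : k⁻¹ * f * k ∈ tame E := by
    refine isTame_of_eqOn_ball (half_pos hε) fun x hx => ?_
    rw [mul_app, mul_app, hball (y := k x) (by rw [hk, dist_eq_norm, add_sub_cancel_right]; linarith),
      inv_app_self]
  have := (inferInstance : (tame E).Normal).conj_mem _ h k
  rwa [show k * (k⁻¹ * f * k) * k⁻¹ = f by group] at this

theorem inv_mul_mem_tame_of_eventuallyEq {f g : E ≃ₜ E} {p : E} (h : ∀ᶠ x in 𝓝 p, f x = g x) :
    f⁻¹ * g ∈ tame E :=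
  mem_tame_of_eventuallyEq_id (p := p) (h.mono fun x hx => by rw [mul_app, ← hx, inv_app_self])

end Tame

section Bounded

variable {E : Type*} [NormedAddCommGroup E] [NormedSpace ℝ E]

/-- The contraction of the space onto its open unit ball. -/
noncomputable def shrink (x : E) : E := (1 + ‖x‖)⁻¹ • x

/-- The inverse of `shrink`. -/
noncomputable def unshrink (y : E) : E := (1 - ‖y‖)⁻¹ • y

lemma norm_shrink (x : E) : ‖shrink x‖ = ‖x‖ / (1 + ‖x‖) := by
  rw [shrink, norm_smul, norm_inv, Real.norm_of_nonneg (by positivity), inv_mul_eq_div]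

lemma one_sub_norm_shrink (x : E) : 1 - ‖shrink x‖ = (1 + ‖x‖)⁻¹ := by
  rw [norm_shrink]
  have : 0 < 1 + ‖x‖ := by positivity
  field_simp
  ring

lemma norm_shrink_lt (x : E) : ‖shrink x‖ < 1 := by
  have h1 := one_sub_norm_shrink x
  have : 0 < (1 + ‖x‖)⁻¹ := by positivity
  linarith

lemma unshrink_shrink (x : E) : unshrink (shrink x) = x := by
  rw [unshrink, one_sub_norm_shrink, inv_inv, shrink, smul_smul, mul_inv_cancel₀ (by positivity),
    one_smul]

lemma norm_unshrink {y : E} (hy : ‖y‖ < 1) : ‖unshrink y‖ = ‖y‖ / (1 - ‖y‖) := by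
  rw [unshrink, norm_smul, norm_inv, Real.norm_of_nonneg (by linarith), inv_mul_eq_div]

lemma one_add_norm_unshrink {y : E} (hy : ‖y‖ < 1) : 1 + ‖unshrink y‖ = (1 - ‖y‖)⁻¹ := by
  rw [norm_unshrink hy]
  have : 1 - ‖y‖ ≠ 0 := by linarith
  field_simp
  ring

lemma shrink_unshrink {y : E} (hy : ‖y‖ < 1) : shrink (unshrink y) = y := by
  have h : 1 - ‖y‖ ≠ 0 := by linarith
  rw [shrink, one_add_norm_unshrink hy, inv_inv, unshrink, smul_smul, mul_inv_cancel₀ h, one_smul]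

lemma norm_shrink_sub_le (a b : E) : ‖shrink a - shrink b‖ ≤ 2 * ‖a - b‖ * (1 + ‖b‖)⁻¹ := by
  have h1 : 0 < 1 + ‖a‖ := by positivity
  have h2 : 0 < 1 + ‖b‖ := by positivity
  have h3 : shrink a - shrink b =
      (1 + ‖b‖)⁻¹ • (a - b) + ((1 + ‖b‖)⁻¹ * ((‖b‖ - ‖a‖) * (1 + ‖a‖)⁻¹)) • a := by
    have : (1 + ‖b‖)⁻¹ * ((‖b‖ - ‖a‖) * (1 + ‖a‖)⁻¹) = (1 + ‖a‖)⁻¹ - (1 + ‖b‖)⁻¹ := by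
      field_simp
      ring
    rw [this, shrink, shrink, sub_smul, smul_sub]
    abel
  have h4 : |‖b‖ - ‖a‖| ≤ ‖a - b‖ := by
    rw [abs_sub_comm]
    exact abs_norm_sub_norm_le a b
  have h5 : ‖a‖ * (1 + ‖a‖)⁻¹ ≤ 1 := by
    rw [← div_eq_mul_inv, div_le_one h1]
    linarith
  rw [h3]
  refine (norm_add_le _ _).trans ?_
  rw [norm_smul, norm_smul, norm_mul, norm_mul, Real.norm_of_nonneg (inv_nonneg.2 h2.le),
    Real.norm_of_nonneg (inv_nonneg.2 h1.le), Real.norm_eq_abs]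
  have h6 : 0 ≤ (1 + ‖b‖)⁻¹ := inv_nonneg.2 h2.le
  calc (1 + ‖b‖)⁻¹ * ‖a - b‖ + (1 + ‖b‖)⁻¹ * (|‖b‖ - ‖a‖| * (1 + ‖a‖)⁻¹) * ‖a‖
      = (1 + ‖b‖)⁻¹ * (‖a - b‖ + |‖b‖ - ‖a‖| * (‖a‖ * (1 + ‖a‖)⁻¹)) := by ring
    _ ≤ (1 + ‖b‖)⁻¹ * (‖a - b‖ + ‖a - b‖ * 1) := by gcongr
    _ = _ := by ring

lemma continuous_shrink : Continuous (shrink : E → E) :=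
  ((continuous_const.add continuous_norm).inv₀ fun x => by
    change (1 + ‖x‖ : ℝ) ≠ 0
    positivity).smul continuous_id

lemma continuousAt_unshrink {y : E} (hy : ‖y‖ < 1) : ContinuousAt (unshrink : E → E) y :=
  ((continuousAt_const.sub continuousAt_id.norm).inv₀ (by
    change (1 - ‖y‖ : ℝ) ≠ 0
    linarith)).smul
    continuousAt_id

open Classical in
/-- The extension to the whole space, by the identity, of a map transported to the unit ball. -/
noncomputable def ballExtend (f : E → E) (y : E) : E :=
  if ‖y‖ < 1 then shrink (f (unshrink y)) else y

lemma ballExtend_shrink (f : E → E) (x : E) : ballExtend f (shrink x) = shrink (f x) := by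
  rw [ballExtend, if_pos (norm_shrink_lt x), unshrink_shrink]

lemma ballExtend_of_le (f : E → E) {y : E} (hy : 1 ≤ ‖y‖) : ballExtend f y = y :=
  if_neg (not_lt.2 hy)

lemma ballExtend_ballExtend {f g : E → E} (h : ∀ x, g (f x) = x) (y : E) :
    ballExtend g (ballExtend f y) = y := by
  rcases lt_or_ge ‖y‖ 1 with hy | hy
  · rw [← shrink_unshrink hy, ballExtend_shrink, ballExtend_shrink, h]
  · rw [ballExtend_of_le f hy, ballExtend_of_le g hy]

lemma continuous_ballExtend {f : E → E} (hf : Continuous f) {C : ℝ} (hC : ∀ x, ‖f x - x‖ ≤ C) :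
    Continuous (ballExtend f) := by
  have hC0 : 0 ≤ C := (norm_nonneg _).trans (hC 0)
  have hbound : ∀ y, ‖ballExtend f y - y‖ ≤ 2 * C * max 0 (1 - ‖y‖) := by
    intro y
    rcases lt_or_ge ‖y‖ 1 with hy | hy
    · obtain ⟨x, rfl⟩ : ∃ x, shrink x = y := ⟨_, shrink_unshrink hy⟩
      rw [ballExtend_shrink, one_sub_norm_shrink]
      refine (norm_shrink_sub_le _ _).trans ?_
      have : 0 ≤ (1 + ‖x‖)⁻¹ := by positivity
      gcongr
      · exact hC x
      · exact le_max_right _ _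
    · rw [ballExtend_of_le f hy, sub_self, norm_zero]
      positivity
  rw [continuous_iff_continuousAt]
  intro y
  rcases lt_or_ge ‖y‖ 1 with hy | hy
  · have h1 : ContinuousAt (fun y => shrink (f (unshrink y))) y :=
      continuous_shrink.continuousAt.comp (hf.continuousAt.comp (continuousAt_unshrink hy))
    refine h1.congr ?_
    filter_upwards [(isOpen_lt continuous_norm continuous_const).mem_nhds hy] with z hz
    exact (if_pos hz).symm
  · have h1 : Tendsto (fun z => ballExtend f z - z) (𝓝 y) (𝓝 0) := by
      refine squeeze_zero_norm hbound ?_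
      have : Continuous fun z : E => 2 * C * max 0 (1 - ‖z‖) := by fun_prop
      have h2 := this.tendsto y
      rwa [max_eq_left (by linarith), mul_zero] at h2
    have h2 := h1.add (tendsto_id (α := E) (x := 𝓝 y))
    simp only [id, sub_add_cancel, zero_add] at h2
    rwa [ContinuousAt, ballExtend_of_le f hy]

lemma exists_profile_shrink {M : ℝ} (hM : 0 ≤ M) : ∃ ρ : ℝ ≃o ℝ, ρ 0 = 0 ∧
    (∀ t, 0 ≤ t → t ≤ M → ρ t = t / (1 + t)) ∧ ρ (1 + M) = 1 := by
  let f : ℝ → ℝ := fun t => t / (1 + max 0 (min t M))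
  have h1 : ∀ t, t ≤ 0 → f t = t := fun t ht => by
    simp only [f]
    rw [max_eq_left ((min_le_left _ _).trans ht)]
    simp
  have h2 : ∀ t, 0 ≤ t → t ≤ M → f t = t / (1 + t) := fun t ht ht' => by
    simp only [f]
    rw [min_eq_left ht', max_eq_right ht]
  have h3 : ∀ t, M ≤ t → f t = t / (1 + M) := fun t ht => by
    simp only [f]
    rw [min_eq_right ht, max_eq_right hM]
  have hmono : StrictMono f := by
    intro s t hst
    simp only [f]
    have hc : ∀ t, 0 < 1 + max 0 (min t M) := fun t => by
      have := le_max_left 0 (min t M)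
      linarith
    rw [div_lt_div_iff₀ (hc s) (hc t)]
    rcases le_or_gt M s with hs | hs
    · rw [min_eq_right hs, min_eq_right (hs.trans hst.le)]
      exact mul_lt_mul_of_pos_right hst (by positivity)
    rw [min_eq_left hs.le]
    rcases le_or_gt 0 s with hs0 | hs0
    · rw [max_eq_right hs0]
      have : max 0 (min t M) ≤ t := max_le (by linarith) (min_le_left _ _)
      nlinarith
    · rw [max_eq_left hs0.le]
      rcases le_or_gt t 0 with ht | ht
      · rw [max_eq_left ((min_le_left _ _).trans ht)]
        linarith
      · nlinarith [hc t]
  have hsurj : Function.Surjective f := by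
    intro y
    rcases le_or_gt y 0 with hy | hy
    · exact ⟨y, h1 y hy⟩
    rcases le_or_gt (y * (1 + M)) M with hyM | hyM
    · have hy1 : 0 < 1 - y := by nlinarith
      refine ⟨y / (1 - y), ?_⟩
      rw [h2 _ (by positivity) (by rw [div_le_iff₀ hy1]; linarith)]
      field_simp
      ring
    · refine ⟨y * (1 + M), ?_⟩
      rw [h3 _ hyM.le]
      field_simp
  refine ⟨hmono.orderIsoOfSurjective f hsurj, h1 0 le_rfl, h2, ?_⟩
  change f (1 + M) = 1
  rw [h3 _ (by linarith)]
  field_simp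

theorem isTame_of_norm_sub_le {f : E ≃ₜ E} {C : ℝ} (hC : ∀ x, ‖f x - x‖ ≤ C) : IsTame f := by
  have hC' : ∀ x, ‖f⁻¹ x - x‖ ≤ C := fun x => by
    have := hC (f⁻¹ x)
    rwa [app_inv_self, norm_sub_rev] at this
  have hC0 : 0 ≤ C := (norm_nonneg _).trans (hC 0)
  intro r
  have hM : 0 ≤ max r 0 + C := by positivity
  obtain ⟨ρ, h0, h1, h2⟩ := exists_profile_shrink hM
  set M := max r 0 + C
  set b : E ≃ₜ E := radial ρ h0
  let g : E ≃ₜ E := mkHomeo (ballExtend f) (ballExtend (f⁻¹ : E ≃ₜ E))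
    (continuous_ballExtend f.continuous hC) (continuous_ballExtend (f⁻¹ : E ≃ₜ E).continuous hC')
    (ballExtend_ballExtend (inv_app_self f)) (ballExtend_ballExtend (app_inv_self f))
  have hb : ∀ x, ‖x‖ ≤ M → b x = shrink x := by
    intro x hx
    rcases eq_or_ne x 0 with rfl | hx0
    · change radialFun ρ 0 = _
      simp [radialFun, shrink]
    · change radialFun ρ x = _
      have := norm_pos_iff.2 hx0
      rw [radialFun, shrink, h1 _ (norm_nonneg x) hx]
      congr 1
      field_simp
  refine ⟨1 + M, b⁻¹ * g * b, fun x hx => ?_, fun x hx => ?_⟩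
  · have h3 : ‖x‖ ≤ max r 0 := hx.trans (le_max_left _ _)
    have h4 : ‖f x‖ ≤ M := by
      have := norm_le_norm_add_norm_sub' (f x) x
      have := hC x
      simp only [M]
      linarith
    rw [mul_app, mul_app, hb x (h3.trans (by simp only [M]; linarith))]
    change b⁻¹ (ballExtend f (shrink x)) = _
    rw [ballExtend_shrink, ← hb _ h4, inv_app_self]
  · have h3 : g (b x) = b x := ballExtend_of_le f (by
      rw [norm_radial, ← h2]
      exact ρ.monotone hx)
    rw [mul_app, mul_app, h3, inv_app_self]

end Bounded

section Shear

/-- The vertical shear `x + i y ↦ x + i (y + φ x)`. -/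
noncomputable def vShear (φ : C(ℝ, ℝ)) : ℂ ≃ₜ ℂ :=
  mkHomeo (fun z => ⟨z.re, z.im + φ z.re⟩) (fun z => ⟨z.re, z.im - φ z.re⟩)
    (by simp only [Complex.mk_eq_add_mul_I]; fun_prop)
    (by simp only [Complex.mk_eq_add_mul_I]; fun_prop)
    (fun z => by simp) (fun z => by simp)

@[simp] lemma vShear_apply (φ : C(ℝ, ℝ)) (z : ℂ) : vShear φ z = ⟨z.re, z.im + φ z.re⟩ := rfl

/-- The reflection exchanging real and imaginary parts. -/
noncomputable def swapHomeo : ℂ ≃ₜ ℂ :=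
  mkHomeo (fun z => ⟨z.im, z.re⟩) (fun z => ⟨z.im, z.re⟩)
    (by simp only [Complex.mk_eq_add_mul_I]; fun_prop)
    (by simp only [Complex.mk_eq_add_mul_I]; fun_prop)
    (fun z => by simp) (fun z => by simp)

/-- The horizontal shear `x + i y ↦ (x + φ y) + i y`. -/
noncomputable def hShear (φ : C(ℝ, ℝ)) : ℂ ≃ₜ ℂ := swapHomeo * vShear φ * swapHomeo⁻¹

@[simp] lemma hShear_apply (φ : C(ℝ, ℝ)) (z : ℂ) : hShear φ z = ⟨z.re + φ z.im, z.im⟩ := rfl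

lemma vShear_mem_tame (φ : C(ℝ, ℝ)) : vShear φ ∈ tame ℂ := by
  let φ₁ : C(ℝ, ℝ) := ⟨fun x => φ (max x 0) - φ 0, by fun_prop⟩
  let φ₂ : C(ℝ, ℝ) := ⟨fun x => φ (min x 0) - φ 0, by fun_prop⟩
  let φ₃ : C(ℝ, ℝ) := ⟨fun _ => φ 0, continuous_const⟩
  have h : vShear φ = vShear φ₁ * vShear φ₂ * vShear φ₃ := by
    refine Homeomorph.ext fun z => Complex.ext ?_ ?_
    · simp
    · rcases le_total z.re 0 with hz | hz <;> simp [φ₁, φ₂, φ₃, hz]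
  rw [h]
  refine mul_mem (mul_mem ?_ ?_) ?_
  · refine mem_tame_of_eventuallyEq_id (p := -1) ?_
    filter_upwards [(isOpen_lt Complex.continuous_re continuous_const).mem_nhds
      (show (-1 : ℂ).re < 0 by simp)] with z hz
    have hz' : max z.re 0 = 0 := max_eq_right (le_of_lt hz)
    simp [φ₁, hz']
  · refine mem_tame_of_eventuallyEq_id (p := 1) ?_
    filter_upwards [(isOpen_lt continuous_const Complex.continuous_re).mem_nhds
      (show 0 < (1 : ℂ).re by simp)] with z hz
    have hz' : min z.re 0 = 0 := min_eq_right (le_of_lt hz)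
    simp [φ₂, hz']
  · refine isTame_of_norm_sub_le (C := ‖(⟨0, φ 0⟩ : ℂ)‖) fun z => le_of_eq (congrArg _ ?_)
    apply Complex.ext <;> simp [φ₃]

lemma hShear_mem_tame (φ : C(ℝ, ℝ)) : hShear φ ∈ tame ℂ :=
  (inferInstance : (tame ℂ).Normal).conj_mem _ (vShear_mem_tame φ) _

lemma exists_continuousMap_interpolating {n : ℕ} {v : Fin n → ℝ} (hv : Function.Injective v)
    (r : Fin n → ℝ) : ∃ φ : C(ℝ, ℝ), ∀ k, φ (v k) = r k :=
  ⟨⟨fun x => (Lagrange.interpolate Finset.univ v r).eval x, Polynomial.continuous _⟩, fun _ =>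
    Lagrange.eval_interpolate_at_node r hv.injOn (Finset.mem_univ _)⟩

lemma exists_mem_tame_apply_eq_diagonal {n : ℕ} {q : Fin n → ℂ} (hq : Function.Injective q) :
    ∃ σ ∈ tame ℂ, ∀ k : Fin n, σ (q k) = ⟨(k : ℕ), (k : ℕ)⟩ := by
  obtain ⟨c, hc⟩ := (Set.finite_range fun p : Fin n × Fin n =>
    ((q p.2).im - (q p.1).im) / ((q p.1).re - (q p.2).re)).exists_notMem
  have hinj : Function.Injective fun k => (q k).im + c * (q k).re := by
    intro j k hjk
    simp only at hjk
    by_contra hne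
    rcases eq_or_ne (q j).re (q k).re with hre | hre
    · refine hne (hq (Complex.ext hre ?_))
      rw [hre] at hjk
      linarith
    · refine hc ⟨(j, k), ?_⟩
      rw [div_eq_iff (sub_ne_zero.2 hre)]
      linarith
  obtain ⟨φ, hφ⟩ := exists_continuousMap_interpolating hinj fun k => (k : ℕ) - (q k).re
  have hinj' : Function.Injective fun k : Fin n => ((k : ℕ) : ℝ) :=
    Nat.cast_injective.comp Fin.val_injective
  obtain ⟨ψ, hψ⟩ := exists_continuousMap_interpolating hinj'
    fun k => (k : ℕ) - ((q k).im + c * (q k).re)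
  refine ⟨vShear ψ * hShear φ * vShear ⟨fun x => c * x, by fun_prop⟩,
    mul_mem (mul_mem (vShear_mem_tame _) (hShear_mem_tame _)) (vShear_mem_tame _), fun k => ?_⟩
  have h1 := hφ k
  have h2 := hψ k
  apply Complex.ext <;> simp [h1, h2]

theorem exists_mem_tame_apply_eq {n : ℕ} {q r : Fin n → ℂ} (hq : Function.Injective q)
    (hr : Function.Injective r) : ∃ σ ∈ tame ℂ, ∀ k, σ (q k) = r k := by
  obtain ⟨σ, hσ, h1⟩ := exists_mem_tame_apply_eq_diagonal hq
  obtain ⟨τ, hτ, h2⟩ := exists_mem_tame_apply_eq_diagonal hr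
  exact ⟨τ⁻¹ * σ, mul_mem (inv_mem hτ) hσ, fun k => by
    rw [mul_app, inv_app_eq, h1, h2]⟩

/-- The diagonal real linear map `x + i y ↦ s x + i t y`. -/
noncomputable def diagHomeo (s t : ℝˣ) : ℂ ≃ₜ ℂ :=
  mkHomeo (fun z => ⟨s * z.re, t * z.im⟩) (fun z => ⟨(s⁻¹ : ℝˣ) * z.re, (t⁻¹ : ℝˣ) * z.im⟩)
    (by simp only [Complex.mk_eq_add_mul_I]; fun_prop)
    (by simp only [Complex.mk_eq_add_mul_I]; fun_prop)
    (fun z => by simp) (fun z => by simp)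

@[simp] lemma diagHomeo_apply (s t : ℝˣ) (z : ℂ) : diagHomeo s t z = ⟨s * z.re, t * z.im⟩ := rfl

lemma commute_diagHomeo (s t s' t' : ℝˣ) : Commute (diagHomeo s t) (diagHomeo s' t') :=
  Homeomorph.ext fun z => by simp [mul_left_comm]

theorem exists_mk_eq_mk_diagHomeo {f : ℂ ≃ₜ ℂ} {a b c d : ℝ}
    (hf : ∀ z : ℂ, f z = ⟨a * z.re + b * z.im, c * z.re + d * z.im⟩) :
    ∃ s t : ℝˣ, (QuotientGroup.mk f : (ℂ ≃ₜ ℂ) ⧸ tame ℂ) = QuotientGroup.mk (diagHomeo s t) := by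
  have key : ∀ {f : ℂ ≃ₜ ℂ} {a b c d : ℝ},
      (∀ z : ℂ, f z = ⟨a * z.re + b * z.im, c * z.re + d * z.im⟩) → a ≠ 0 → ∃ s t : ℝˣ,
      (QuotientGroup.mk f : (ℂ ≃ₜ ℂ) ⧸ tame ℂ) = QuotientGroup.mk (diagHomeo s t) := by
    intro f a b c d hf ha
    have hd : d - c * b / a ≠ 0 := by
      intro h0
      have h1 : f ⟨-b, a⟩ = f 0 := by
        rw [hf, hf]
        apply Complex.ext
        · simp only [Complex.zero_re, Complex.zero_im]
          ring
        · simp only [Complex.zero_re, Complex.zero_im]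
          field_simp at h0
          linarith
      have h2 := congrArg Complex.im (f.injective h1)
      exact ha (by simpa using h2)
    refine ⟨Units.mk0 a ha, Units.mk0 _ hd, ?_⟩
    have h : f = vShear ⟨fun x => c / a * x, by fun_prop⟩ *
        diagHomeo (Units.mk0 a ha) (Units.mk0 _ hd) * hShear ⟨fun y => b / a * y, by fun_prop⟩ := by
      refine Homeomorph.ext fun z => Complex.ext ?_ ?_
      · simp only [hf, mul_app, vShear_apply, hShear_apply, diagHomeo_apply, Units.val_mk0,
          ContinuousMap.coe_mk]
        field_simp
      · simp only [hf, mul_app, vShear_apply, hShear_apply, diagHomeo_apply, Units.val_mk0,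
          ContinuousMap.coe_mk]
        field_simp
        ring
    rw [h, QuotientGroup.mk_mul, QuotientGroup.mk_mul,
      (QuotientGroup.eq_one_iff _).2 (vShear_mem_tame _),
      (QuotientGroup.eq_one_iff _).2 (hShear_mem_tame _), one_mul, mul_one]
  rcases eq_or_ne a 0 with rfl | ha
  · have hb : b ≠ 0 := by
      rintro rfl
      obtain ⟨z, hz⟩ := f.surjective 1
      have := congrArg Complex.re hz
      simp [hf] at this
    have h := key (f := f * vShear ⟨fun x => x, by fun_prop⟩) (a := b) (b := b) (c := c + d) (d := d)
      (fun z => by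
        rw [mul_app, hf]
        apply Complex.ext
        · simp
          ring
        · simp
          ring) hb
    rwa [QuotientGroup.mk_mul, (QuotientGroup.eq_one_iff _).2 (vShear_mem_tame _), mul_one] at h
  · exact key hf ha

end Shear

section SquareRoot

open Complex (exp I)

lemma exists_continuous_exp_eq {g : ℂ → ℂ} (hg : Continuous g) (h0 : ∀ x, g x ≠ 0) :
    ∃ f : ℂ → ℂ, Continuous f ∧ ∀ x, exp (f x) = g x := by
  have : ContractibleSpace (univ : Set ℂ) := convex_univ.contractibleSpace univ_nonempty
  have hsc : IsSimplyConnected (univ : Set ℂ) := SimplyConnectedSpace.ofContractible _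
  obtain ⟨f, hf, h⟩ := Complex.exists_continuousOn_eqOn_exp_comp hsc isOpen_univ
    hg.continuousOn (by simpa using h0)
  exact ⟨f, continuousOn_univ.1 hf, fun x => h (mem_univ x)⟩

lemma exists_eq_intCast_of_continuous {X : Type*} [TopologicalSpace X] [PreconnectedSpace X]
    [Nonempty X] {f : X → ℝ} (hf : Continuous f) (h : ∀ x, ∃ n : ℤ, f x = n) :
    ∃ n : ℤ, ∀ x, f x = n := by
  choose g hg using h
  have h1 : f = Int.cast ∘ g := funext hg
  have h2 : Continuous g := by
    rw [Int.isClosedEmbedding_coe_real.isInducing.continuous_iff, ← h1]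
    exact hf
  inhabit X
  exact ⟨g default, fun x => by rw [hg, PreconnectedSpace.constant ‹_› h2 (x := x) (y := default)]⟩

lemma exists_eq_intCast_mul_of_continuous {X : Type*} [TopologicalSpace X] [PreconnectedSpace X]
    [Nonempty X] {f : X → ℂ} (hf : Continuous f) {c : ℂ} (hc : c ≠ 0)
    (h : ∀ x, ∃ n : ℤ, f x = n * c) : ∃ n : ℤ, ∀ x, f x = n * c := by
  have h1 : ∀ x, ∃ n : ℤ, (f x / c).re = n := fun x => by
    obtain ⟨n, hn⟩ := h x
    exact ⟨n, by rw [hn, mul_div_cancel_right₀ _ hc, Complex.intCast_re]⟩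
  obtain ⟨n, hn⟩ := exists_eq_intCast_of_continuous
    (Complex.continuous_re.comp (hf.div_const c)) h1
  refine ⟨n, fun x => ?_⟩
  obtain ⟨m, hm⟩ := h x
  have := hn x
  simp only [Function.comp, hm, mul_div_cancel_right₀ _ hc, Complex.intCast_re] at this
  rw [hm, Int.cast_injective this]

/-- The increment of a lift along a period. -/
lemma exists_lift_add_period {L : ℂ → ℂ} (hL : Continuous L)
    (h : ∀ w, exp (L (w + 2 * Real.pi * I)) = exp (L w)) :
    ∃ k : ℤ, ∀ (n : ℤ) w, L (w + n * (2 * Real.pi * I)) = L w + n * (k * (2 * Real.pi * I)) := by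
  obtain ⟨k, hk⟩ := exists_eq_intCast_mul_of_continuous
    (f := fun w => L (w + 2 * Real.pi * I) - L w) (by fun_prop) Complex.two_pi_I_ne_zero
    (fun w => by
      obtain ⟨n, hn⟩ := Complex.exp_eq_exp_iff_exists_int.1 (h w)
      exact ⟨n, by rw [hn]; ring⟩)
  refine ⟨k, fun n => ?_⟩
  have hk' : ∀ w, L (w + 2 * Real.pi * I) = L w + k * (2 * Real.pi * I) := fun w => by
    rw [← hk w]
    ring
  induction n using Int.induction_on with
  | zero => simp
  | succ n ih =>
    intro w
    have := hk' (w + (n : ℤ) * (2 * Real.pi * I))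
    rw [ih] at this
    push_cast at this ⊢
    rw [show w + (n + 1) * (2 * Real.pi * I) = w + n * (2 * Real.pi * I) + 2 * Real.pi * I by ring,
      this]
    ring
  | pred n ih =>
    intro w
    have := hk' (w + (-(n : ℤ) - 1 : ℤ) * (2 * Real.pi * I))
    rw [show w + (-(n : ℤ) - 1 : ℤ) * (2 * Real.pi * I) + 2 * Real.pi * I =
      w + (-(n : ℤ) : ℤ) * (2 * Real.pi * I) by push_cast; ring, ih] at this
    push_cast at this ⊢
    linear_combination -this

/-- A homeomorphism of the plane has a square root of its displacement ratio at a fixed point. -/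
theorem exists_sq_eq_div (h : ℂ ≃ₜ ℂ) {e : ℂ} (he : h e = e) :
    ∃ v : ℂ → ℂ, (∀ x, x ≠ e → ContinuousAt v x) ∧
      ∀ x, x ≠ e → v x ^ 2 = (h x - e) / (x - e) := by
  have hlog : ∀ f : ℂ ≃ₜ ℂ, f e = e → ∃ L : ℂ → ℂ, Continuous L ∧
      ∀ w, exp (L w) = f (e + exp w) - e := fun f hf =>
    exists_continuous_exp_eq (by fun_prop) fun w h0 => Complex.exp_ne_zero w (by
      have := f.injective ((sub_eq_zero.1 h0).trans hf.symm)
      simp at this)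
  have hper : ∀ w n, exp (w + (n : ℤ) * (2 * Real.pi * I)) = exp w := fun w n =>
    Complex.exp_eq_exp_iff_exists_int.2 ⟨n, rfl⟩
  have hper' : ∀ w, exp (w + 2 * Real.pi * I) = exp w := fun w => by simpa using hper w 1
  obtain ⟨L, hL, hL'⟩ := hlog h he
  obtain ⟨K, hK, hK'⟩ := hlog h⁻¹ (inv_app_eq.2 he.symm)
  obtain ⟨k, hk⟩ := exists_lift_add_period hL fun w => by rw [hL', hL', hper']
  obtain ⟨l, hl⟩ := exists_lift_add_period hK fun w => by rw [hK', hK', hper']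
  obtain ⟨m, hm⟩ := exists_eq_intCast_mul_of_continuous (f := fun w => K (L w) - w)
    (by fun_prop) Complex.two_pi_I_ne_zero (fun w => by
      have : exp (K (L w)) = exp w := by
        rw [hK', hL', add_sub_cancel, inv_app_self, add_sub_cancel_left]
      obtain ⟨n, hn⟩ := Complex.exp_eq_exp_iff_exists_int.1 this
      exact ⟨n, by rw [hn]; ring⟩)
  have hkl : k * l = 1 := by
    have h1 := hm ((1 : ℤ) * (2 * Real.pi * I))
    have h2 := hm 0
    have h3 := hk 1 0
    rw [zero_add] at h3
    have h4 := hl k (L 0)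
    rw [h3, Int.cast_one, one_mul, one_mul, h4] at h1
    have h5 : (k * l - 1 : ℂ) * (2 * Real.pi * I) = 0 := by
      linear_combination h1 - h2
    have h6 := (mul_eq_zero.1 h5).resolve_right Complex.two_pi_I_ne_zero
    exact_mod_cast sub_eq_zero.1 h6
  obtain ⟨j, hj⟩ : ∃ j : ℤ, k - 1 = 2 * j := by
    rcases Int.eq_one_or_neg_one_of_mul_eq_one hkl with rfl | rfl
    · exact ⟨0, by norm_num⟩
    · exact ⟨-1, by norm_num⟩
  have hj' : (k - 1 : ℂ) = 2 * j := by exact_mod_cast hj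
  have hv : ∀ w w', exp w = exp w' → exp ((L w - w) / 2) = exp ((L w' - w') / 2) := by
    intro w w' hww
    obtain ⟨n, rfl⟩ := Complex.exp_eq_exp_iff_exists_int.1 hww
    refine Complex.exp_eq_exp_iff_exists_int.2 ⟨n * j, ?_⟩
    rw [hk]
    push_cast
    linear_combination (n * Real.pi * I : ℂ) * hj'
  let v : ℂ → ℂ := fun x => exp ((L (Complex.log (x - e)) - Complex.log (x - e)) / 2)
  have hvw : ∀ x w, exp w = x - e → v x = exp ((L w - w) / 2) := fun x w hw =>
    hv _ _ (by rw [hw, Complex.exp_log]; rw [← hw]; exact Complex.exp_ne_zero w)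
  refine ⟨v, fun x hx => ?_, fun x hx => ?_⟩
  · have hx0 := sub_ne_zero.2 hx
    rcases Complex.mem_slitPlane_or_neg_mem_slitPlane hx0 with hs | hs
    · have h1 : ContinuousAt (fun x => Complex.log (x - e)) x :=
        ContinuousAt.clog (by fun_prop) hs
      have h2 : Continuous fun w => exp ((L w - w) / 2) := by fun_prop
      exact h2.continuousAt.comp h1
    · have h1 : ContinuousAt (fun x => Complex.log (-(x - e)) + Real.pi * I) x :=
        (ContinuousAt.clog (f := fun x => -(x - e)) (by fun_prop) hs).add continuousAt_const
      have h2 : Continuous fun w => exp ((L w - w) / 2) := by fun_prop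
      refine (ContinuousAt.comp (x := x) h2.continuousAt h1).congr ?_
      filter_upwards [isOpen_ne.mem_nhds hx] with y hy
      refine (hvw _ _ ?_).symm
      rw [Complex.exp_add, Complex.exp_log (neg_ne_zero.2 (sub_ne_zero.2 hy)), Complex.exp_pi_mul_I]
      ring
  · have hx0 := sub_ne_zero.2 hx
    have h1 := hL' (Complex.log (x - e))
    rw [Complex.exp_log hx0, add_sub_cancel] at h1
    simp only [v]
    rw [← Complex.exp_nat_mul]
    push_cast
    rw [mul_div_cancel₀ _ two_ne_zero, Complex.exp_sub, h1, Complex.exp_log hx0]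

end SquareRoot

section Pillowcase

/-! The surface `e ^ 2 = 2 * (1 - c ^ 2) * (1 - d ^ 2)` with `|c|, |d| ≤ 1` is a sphere, identified
with the extended plane by radial projection to a round sphere in the coordinates
`(c + d, d - c, e)`, followed by stereographic projection. -/

/-- The distance from the origin to the surface in the direction with first two coordinates
`u` and `v`. -/
noncomputable def surfRadius (u v : ℝ) : ℝ := 2 / √(1 + √(1 - (u ^ 2 - v ^ 2) ^ 2))

lemma tendsto_surfRadius {α : Type*} {l : Filter α} {f g : α → ℝ} {u v : ℝ}
    (hf : Tendsto f l (𝓝 u)) (hg : Tendsto g l (𝓝 v)) :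
    Tendsto (fun x => surfRadius (f x) (g x)) l (𝓝 (surfRadius u v)) := by
  unfold surfRadius
  refine tendsto_const_nhds.div ?_ (by positivity)
  exact (((((hf.pow 2).sub (hg.pow 2)).pow 2).const_sub 1).sqrt.const_add 1).sqrt

lemma surfRadius_pos (u v : ℝ) : 0 < surfRadius u v := by
  unfold surfRadius
  positivity

/-- First coordinate of the inverse stereographic projection. -/
noncomputable def stereoX (ζ : ℂ) : ℝ := (ζ.re ^ 2 + ζ.im ^ 2 - 1) / (ζ.re ^ 2 + ζ.im ^ 2 + 1)

/-- Second coordinate of the inverse stereographic projection. -/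
noncomputable def stereoY (ζ : ℂ) : ℝ := 2 * ζ.re / (ζ.re ^ 2 + ζ.im ^ 2 + 1)

/-- Third coordinate of the inverse stereographic projection. -/
noncomputable def stereoZ (ζ : ℂ) : ℝ := 2 * ζ.im / (ζ.re ^ 2 + ζ.im ^ 2 + 1)

lemma stereo_sq (ζ : ℂ) : stereoX ζ ^ 2 + stereoY ζ ^ 2 + stereoZ ζ ^ 2 = 1 := by
  unfold stereoX stereoY stereoZ
  have : ζ.re ^ 2 + ζ.im ^ 2 + 1 ≠ 0 := by positivity
  field_simp
  ring

lemma continuous_stereoX : Continuous stereoX :=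
  Continuous.div (by fun_prop) (by fun_prop) fun _ => by positivity

lemma continuous_stereoY : Continuous stereoY :=
  Continuous.div (by fun_prop) (by fun_prop) fun _ => by positivity

lemma continuous_stereoZ : Continuous stereoZ :=
  Continuous.div (by fun_prop) (by fun_prop) fun _ => by positivity

/-- The distance from the origin to the point of the surface corresponding to `ζ`. -/
noncomputable def surfR (ζ : ℂ) : ℝ := surfRadius (stereoX ζ) (stereoY ζ)

/-- The coordinate `c` of the point of the surface corresponding to `ζ`. -/
noncomputable def surfC (ζ : ℂ) : ℝ := surfR ζ * (stereoX ζ - stereoY ζ) / 2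

/-- The coordinate `d` of the point of the surface corresponding to `ζ`. -/
noncomputable def surfD (ζ : ℂ) : ℝ := surfR ζ * (stereoX ζ + stereoY ζ) / 2

/-- The coordinate `e` of the point of the surface corresponding to `ζ`. -/
noncomputable def surfE (ζ : ℂ) : ℝ := surfR ζ * stereoZ ζ

lemma surfR_pos (ζ : ℂ) : 0 < surfR ζ := surfRadius_pos _ _

lemma continuous_surfR : Continuous surfR :=
  continuous_iff_continuousAt.2 fun ζ =>
    tendsto_surfRadius (continuous_stereoX.tendsto ζ) (continuous_stereoY.tendsto ζ)

lemma continuous_surfC : Continuous surfC :=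
  (continuous_surfR.mul (continuous_stereoX.sub continuous_stereoY)).div_const 2

lemma continuous_surfD : Continuous surfD :=
  (continuous_surfR.mul (continuous_stereoX.add continuous_stereoY)).div_const 2

lemma continuous_surfE : Continuous surfE := continuous_surfR.mul continuous_stereoZ

lemma surfR_sq (ζ : ℂ) :
    surfR ζ ^ 2 = 2 + 2 * surfC ζ ^ 2 * surfD ζ ^ 2 ∧ surfC ζ ^ 2 * surfD ζ ^ 2 ≤ 1 := by
  set k := stereoX ζ ^ 2 - stereoY ζ ^ 2 with hk
  have h0 : 0 ≤ 1 - k ^ 2 := by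
    have := stereo_sq ζ
    nlinarith [sq_nonneg (stereoX ζ), sq_nonneg (stereoY ζ), sq_nonneg (stereoZ ζ)]
  have h1 : surfC ζ ^ 2 * surfD ζ ^ 2 = (surfR ζ ^ 2) ^ 2 * k ^ 2 / 16 := by
    rw [surfC, surfD, hk]
    ring
  set s := √(1 - k ^ 2) with hs
  have hs0 : 0 ≤ s := Real.sqrt_nonneg _
  have hs2 : s ^ 2 = 1 - k ^ 2 := Real.sq_sqrt h0
  have h2 : surfR ζ ^ 2 = 4 / (1 + s) := by
    rw [surfR, surfRadius, ← hk, ← hs, div_pow, Real.sq_sqrt (by positivity)]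
    norm_num
  have h3 : k ^ 2 = 1 - s ^ 2 := by linarith
  rw [h1, mul_assoc, h1, h2, h3]
  have : 1 + s ≠ 0 := by positivity
  constructor
  · field_simp
    ring
  · rw [div_pow, div_mul_eq_mul_div, div_div, div_le_one (by positivity)]
    nlinarith

lemma surfE_sq (ζ : ℂ) : surfE ζ ^ 2 = 2 * (1 - surfC ζ ^ 2) * (1 - surfD ζ ^ 2) := by
  have h1 := (surfR_sq ζ).1
  have h2 := stereo_sq ζ
  have h3 : surfC ζ ^ 2 + surfD ζ ^ 2 = surfR ζ ^ 2 * (stereoX ζ ^ 2 + stereoY ζ ^ 2) / 2 := by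
    rw [surfC, surfD]
    ring
  have h4 : surfE ζ ^ 2 = surfR ζ ^ 2 * stereoZ ζ ^ 2 := by
    rw [surfE]
    ring
  linear_combination h4 + h1 + 2 * h3 + surfR ζ ^ 2 * h2

lemma surf_sq_le_one (ζ : ℂ) : surfC ζ ^ 2 ≤ 1 ∧ surfD ζ ^ 2 ≤ 1 := by
  have h1 := (surfR_sq ζ).2
  have h2 := surfE_sq ζ
  constructor <;> by_contra! h <;>
    nlinarith [sq_nonneg (surfE ζ), sq_nonneg (surfC ζ), sq_nonneg (surfD ζ)]

/-- The point of the plane corresponding to the point `(c, d, e)` of the surface. -/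
noncomputable def surfProj (c d e : ℝ) : ℂ :=
  ⟨(d - c) / (√(2 + 2 * c ^ 2 * d ^ 2) - (c + d)), e / (√(2 + 2 * c ^ 2 * d ^ 2) - (c + d))⟩

lemma surfProj_surf (ζ : ℂ) : surfProj (surfC ζ) (surfD ζ) (surfE ζ) = ζ := by
  have h1 : √(2 + 2 * surfC ζ ^ 2 * surfD ζ ^ 2) = surfR ζ := by
    rw [← (surfR_sq ζ).1, Real.sqrt_sq (surfR_pos ζ).le]
  have h2 : surfR ζ - (surfC ζ + surfD ζ) = surfR ζ * (2 / (ζ.re ^ 2 + ζ.im ^ 2 + 1)) := by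
    rw [surfC, surfD, stereoX, stereoY]
    have : ζ.re ^ 2 + ζ.im ^ 2 + 1 ≠ 0 := by positivity
    field_simp
    ring
  have h0 := (surfR_pos ζ).ne'
  have h3 : ζ.re ^ 2 + ζ.im ^ 2 + 1 ≠ 0 := by positivity
  apply Complex.ext
  · simp only [surfProj, h1, h2]
    rw [surfC, surfD, stereoY]
    field_simp
    ring
  · simp only [surfProj, h1, h2]
    rw [surfE, stereoZ]
    field_simp

lemma add_lt_sqrt {c d : ℝ} (hc : c ^ 2 ≤ 1) (hd : d ^ 2 ≤ 1) (hcd : ¬(c = 1 ∧ d = 1)) :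
    c + d < √(2 + 2 * c ^ 2 * d ^ 2) := by
  rcases lt_or_ge (c + d) 0 with h | h
  · exact h.trans_le (Real.sqrt_nonneg _)
  rw [Real.lt_sqrt h]
  by_contra! h1
  have h2 : (d - c) ^ 2 + 2 * (1 - c ^ 2) * (1 - d ^ 2) ≤ 0 := by nlinarith
  have h3 : 0 ≤ (1 - c ^ 2) * (1 - d ^ 2) :=
    mul_nonneg (by linarith) (by linarith)
  have h4 : d - c = 0 := by
    have : (d - c) ^ 2 = 0 := le_antisymm (by nlinarith) (sq_nonneg _)
    exact pow_eq_zero_iff two_ne_zero |>.1 this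
  obtain rfl : d = c := by linarith
  have h5 : 1 - d ^ 2 = 0 := by
    have : (1 - d ^ 2) ^ 2 = 0 := le_antisymm (by nlinarith) (sq_nonneg _)
    exact pow_eq_zero_iff two_ne_zero |>.1 this
  have h6 : d = 1 := by nlinarith
  exact hcd ⟨h6, h6⟩

section

variable {c d e : ℝ} (hc : c ^ 2 ≤ 1) (hd : d ^ 2 ≤ 1) (hcd : ¬(c = 1 ∧ d = 1))
  (he : e ^ 2 = 2 * (1 - c ^ 2) * (1 - d ^ 2))

include hc hd hcd he in
lemma normSq_surfProj : (surfProj c d e).re ^ 2 + (surfProj c d e).im ^ 2 =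
    (√(2 + 2 * c ^ 2 * d ^ 2) + (c + d)) / (√(2 + 2 * c ^ 2 * d ^ 2) - (c + d)) := by
  have h1 := add_lt_sqrt hc hd hcd
  have h2 : √(2 + 2 * c ^ 2 * d ^ 2) ^ 2 = 2 + 2 * c ^ 2 * d ^ 2 := Real.sq_sqrt (by positivity)
  simp only [surfProj]
  set r := √(2 + 2 * c ^ 2 * d ^ 2)
  have h3 : r - (c + d) ≠ 0 := by linarith
  field_simp
  linear_combination he - h2

include hc hd hcd he in
lemma surf_surfProj : surfC (surfProj c d e) = c ∧ surfD (surfProj c d e) = d ∧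
    surfE (surfProj c d e) = e := by
  have hn := normSq_surfProj hc hd hcd he
  have h1 := add_lt_sqrt hc hd hcd
  have hr2 : √(2 + 2 * c ^ 2 * d ^ 2) ^ 2 = 2 + 2 * c ^ 2 * d ^ 2 := Real.sq_sqrt (by positivity)
  have hr : 0 < √(2 + 2 * c ^ 2 * d ^ 2) := by positivity
  have hre : (surfProj c d e).re = (d - c) / (√(2 + 2 * c ^ 2 * d ^ 2) - (c + d)) := rfl
  have him : (surfProj c d e).im = e / (√(2 + 2 * c ^ 2 * d ^ 2) - (c + d)) := rfl
  set ζ := surfProj c d e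
  set r := √(2 + 2 * c ^ 2 * d ^ 2)
  have h3 : 0 < r - (c + d) := by linarith
  have hN : ζ.re ^ 2 + ζ.im ^ 2 + 1 = 2 * r / (r - (c + d)) := by
    rw [hn]
    field_simp
    ring
  have hX : stereoX ζ = (c + d) / r := by
    rw [stereoX, hN, hn]
    field_simp
    ring
  have hY : stereoY ζ = (d - c) / r := by
    rw [stereoY, hN, hre]
    field_simp
  have hZ : stereoZ ζ = e / r := by
    rw [stereoZ, hN, him]
    field_simp
  have hR : surfR ζ = r := by
    have hcd1 : c ^ 2 * d ^ 2 ≤ 1 := by nlinarith [sq_nonneg c, sq_nonneg d]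
    have h4 : 1 - (((c + d) / r) ^ 2 - ((d - c) / r) ^ 2) ^ 2 =
        (2 * (1 - c ^ 2 * d ^ 2) / r ^ 2) ^ 2 := by
      field_simp
      linear_combination (r ^ 2 + 2 + 2 * c ^ 2 * d ^ 2) * hr2
    have h5 : 1 + 2 * (1 - c ^ 2 * d ^ 2) / r ^ 2 = (2 / r) ^ 2 := by
      field_simp
      linear_combination hr2
    rw [surfR, surfRadius, hX, hY, h4, Real.sqrt_sq
      (div_nonneg (by linarith) (by positivity)), h5, Real.sqrt_sq (by positivity)]
    field_simp
  refine ⟨?_, ?_, ?_⟩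
  · rw [surfC, hR, hX, hY]
    field_simp
    ring
  · rw [surfD, hR, hX, hY]
    field_simp
    ring
  · rw [surfE, hR, hZ]
    field_simp

end

lemma surf_ne_one (ζ : ℂ) : ¬(surfC ζ = 1 ∧ surfD ζ = 1) := by
  rintro ⟨h1, h2⟩
  have h3 := (surfR_sq ζ).1
  have h4 : 0 < surfR ζ - (surfC ζ + surfD ζ) := by
    have : surfR ζ - (surfC ζ + surfD ζ) = surfR ζ * (2 / (ζ.re ^ 2 + ζ.im ^ 2 + 1)) := by
      rw [surfC, surfD, stereoX, stereoY]
      have : ζ.re ^ 2 + ζ.im ^ 2 + 1 ≠ 0 := by positivity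
      field_simp
      ring
    rw [this]
    have := surfR_pos ζ
    positivity
  rw [h1, h2] at h3 h4
  nlinarith

lemma tendsto_stereo_cocompact : Tendsto stereoX (cocompact ℂ) (𝓝 1) ∧
    Tendsto stereoY (cocompact ℂ) (𝓝 0) ∧ Tendsto stereoZ (cocompact ℂ) (𝓝 0) := by
  have h1 : Tendsto (fun ζ : ℂ => 2 * ‖ζ‖⁻¹) (cocompact ℂ) (𝓝 0) := by
    simpa using (tendsto_inv_atTop_zero.comp (tendsto_norm_cocompact_atTop (E := ℂ))).const_mul 2
  have hn : ∀ ζ : ℂ, ζ.re ^ 2 + ζ.im ^ 2 = ‖ζ‖ ^ 2 := fun ζ => by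
    rw [Complex.sq_norm, Complex.normSq_apply]
    ring
  have hev : ∀ᶠ ζ : ℂ in cocompact ℂ, 1 ≤ ‖ζ‖ :=
    (tendsto_norm_cocompact_atTop (E := ℂ)).eventually_ge_atTop 1
  have key : ∀ (ζ : ℂ) (t : ℝ), 1 ≤ ‖ζ‖ → |t| ≤ ‖ζ‖ →
      ‖2 * t / (ζ.re ^ 2 + ζ.im ^ 2 + 1)‖ ≤ 2 * ‖ζ‖⁻¹ := by
    intro ζ t h ht
    rw [hn, Real.norm_eq_abs, abs_div, abs_mul, abs_two, abs_of_pos (by positivity : 0 < ‖ζ‖ ^ 2 + 1),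
      div_le_iff₀ (by positivity)]
    have : 0 < ‖ζ‖ := by linarith
    field_simp
    nlinarith
  refine ⟨?_, squeeze_zero_norm' ?_ h1, squeeze_zero_norm' ?_ h1⟩
  · rw [tendsto_iff_norm_sub_tendsto_zero]
    refine squeeze_zero_norm' ?_ h1
    filter_upwards [hev] with ζ hζ
    rw [norm_norm]
    have h2 : stereoX ζ - 1 = 2 * -1 / (ζ.re ^ 2 + ζ.im ^ 2 + 1) := by
      rw [stereoX]
      have : ζ.re ^ 2 + ζ.im ^ 2 + 1 ≠ 0 := by positivity
      field_simp
      ring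
    rw [h2]
    exact key ζ (-1) hζ (by simpa using hζ)
  · filter_upwards [hev] with ζ hζ using key ζ _ hζ (Complex.abs_re_le_norm ζ)
  · filter_upwards [hev] with ζ hζ using key ζ _ hζ (Complex.abs_im_le_norm ζ)

lemma tendsto_surf_cocompact : Tendsto surfC (cocompact ℂ) (𝓝 1) ∧
    Tendsto surfD (cocompact ℂ) (𝓝 1) ∧ Tendsto surfE (cocompact ℂ) (𝓝 0) := by
  obtain ⟨hX, hY, hZ⟩ := tendsto_stereo_cocompact
  have hR : Tendsto surfR (cocompact ℂ) (𝓝 2) := by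
    have h3 : Tendsto surfR (cocompact ℂ) (𝓝 (surfRadius 1 0)) := tendsto_surfRadius hX hY
    rwa [show surfRadius 1 0 = 2 by norm_num [surfRadius]] at h3
  have hC := (hR.mul (hX.sub hY)).div_const 2
  have hD := (hR.mul (hX.add hY)).div_const 2
  have hE := hR.mul hZ
  rw [show (2 : ℝ) * (1 - 0) / 2 = 1 by norm_num] at hC
  rw [show (2 : ℝ) * (1 + 0) / 2 = 1 by norm_num] at hD
  rw [mul_zero] at hE
  exact ⟨hC, hD, hE⟩

end Pillowcase

section Branch

open Complex (exp I)

/-- The function on the plane whose square root uniformizes the pillowcase. -/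
noncomputable def surfW (ζ : ℂ) : ℂ := ⟨surfD ζ ^ 2 - surfC ζ ^ 2, √2 * surfE ζ⟩

lemma continuous_surfW : Continuous surfW := by
  have h1 := continuous_surfC
  have h2 := continuous_surfD
  have h3 := continuous_surfE
  unfold surfW
  simp only [Complex.mk_eq_add_mul_I]
  fun_prop

/-- The polynomial vanishing at the finite branch points. -/
noncomputable def branchPoly (ζ : ℂ) : ℂ := ζ * (ζ ^ 2 - 1)

lemma branchPoly_eq_zero {ζ : ℂ} : branchPoly ζ = 0 ↔ ζ = 0 ∨ ζ = 1 ∨ ζ = -1 := by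
  rw [branchPoly, mul_eq_zero, sub_eq_zero, ← one_pow (M := ℂ) 2, sq_eq_sq_iff_eq_or_eq_neg,
    one_pow]

lemma surfW_eq (ζ : ℂ) : surfW ζ =
    ⟨surfR ζ ^ 2 * (2 * ζ.re * (ζ.re ^ 2 + ζ.im ^ 2 - 1)) / (ζ.re ^ 2 + ζ.im ^ 2 + 1) ^ 2,
      √2 * surfR ζ * (2 * ζ.im) / (ζ.re ^ 2 + ζ.im ^ 2 + 1)⟩ := by
  have : ζ.re ^ 2 + ζ.im ^ 2 + 1 ≠ 0 := by positivity
  apply Complex.ext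
  · simp only [surfW, surfC, surfD, stereoX, stereoY]
    field_simp
    ring
  · simp only [surfW, surfE, stereoZ]
    field_simp

lemma surfW_eq_zero_of_branchPoly {ζ : ℂ} (h : branchPoly ζ = 0) : surfW ζ = 0 := by
  rw [surfW_eq]
  rcases branchPoly_eq_zero.1 h with rfl | rfl | rfl <;> apply Complex.ext <;> simp

/-- Numerator of `branchPoly` after division by a square of unit complex numbers. -/
noncomputable def branchAux (ζ : ℂ) : ℂ :=
  ⟨ζ.re * (ζ.re ^ 2 + ζ.im ^ 2 - 1), ζ.im * (ζ.re ^ 2 + ζ.im ^ 2 + 1)⟩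

lemma continuous_branchAux : Continuous branchAux := by
  unfold branchAux
  simp only [Complex.mk_eq_add_mul_I]
  fun_prop

lemma mul_branchAux (ζ : ℂ) : ζ * branchAux ζ = (‖ζ‖ : ℂ) ^ 2 * (ζ ^ 2 - 1) := by
  have h : (‖ζ‖ : ℂ) ^ 2 = ((ζ.re ^ 2 + ζ.im ^ 2 : ℝ) : ℂ) := by
    rw [← Complex.ofReal_pow, Complex.sq_norm, Complex.normSq_apply, pow_two, pow_two]
  rw [h]
  apply Complex.ext <;> simp [branchAux, pow_two] <;> ring

lemma branchAux_ne_zero {ζ : ℂ} (h : branchPoly ζ ≠ 0) : branchAux ζ ≠ 0 := by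
  intro h0
  have h1 := mul_branchAux ζ
  rw [h0, mul_zero] at h1
  have h2 := mul_ne_zero_iff.1 h
  rcases mul_eq_zero.1 h1.symm with h3 | h3
  · exact h2.1 (by simpa using h3)
  · exact h2.2 h3

lemma re_surfW_div_pos {ζ : ℂ} (h : branchPoly ζ ≠ 0) : 0 < (surfW ζ / branchAux ζ).re := by
  have h1 := branchAux_ne_zero h
  have h2 := surfR_pos ζ
  have h3 : 0 < ζ.re ^ 2 + ζ.im ^ 2 + 1 := by positivity
  have h4 : 0 < Complex.normSq (branchAux ζ) := Complex.normSq_pos.2 h1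
  rw [Complex.div_re, ← add_div]
  refine div_pos ?_ h4
  rw [surfW_eq]
  have h5 : branchAux ζ = ⟨(branchAux ζ).re, (branchAux ζ).im⟩ := rfl
  set u := (branchAux ζ).re with hu
  set v := (branchAux ζ).im with hv
  have h6 : (surfR ζ ^ 2 * (2 * ζ.re * (ζ.re ^ 2 + ζ.im ^ 2 - 1)) / (ζ.re ^ 2 + ζ.im ^ 2 + 1) ^ 2) =
      2 * surfR ζ ^ 2 / (ζ.re ^ 2 + ζ.im ^ 2 + 1) ^ 2 * u := by
    rw [hu, branchAux]
    ring
  have h7 : √2 * surfR ζ * (2 * ζ.im) / (ζ.re ^ 2 + ζ.im ^ 2 + 1) =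
      2 * √2 * surfR ζ / (ζ.re ^ 2 + ζ.im ^ 2 + 1) ^ 2 * v := by
    rw [hv, branchAux]
    field_simp
  rw [h6, h7, mul_assoc, mul_assoc]
  rcases eq_or_ne u 0 with hu0 | hu0
  · have hv0 : v ≠ 0 := by
      rintro hv0
      rw [hu0, hv0] at h5
      exact h1 h5
    have := mul_self_pos.2 hv0
    rw [hu0]
    positivity
  · have := mul_self_pos.2 hu0
    have h8 := mul_self_nonneg v
    positivity

lemma surfW_ne_zero {ζ : ℂ} (h : branchPoly ζ ≠ 0) : surfW ζ ≠ 0 := by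
  intro h0
  have := re_surfW_div_pos h
  simp [h0] at this

lemma surfW_eq_zero {ζ : ℂ} : surfW ζ = 0 ↔ branchPoly ζ = 0 :=
  ⟨fun h => not_imp_not.1 surfW_ne_zero h, surfW_eq_zero_of_branchPoly⟩

lemma exists_surfW_eq_mul_sq : ∃ m : ℂ → ℂ, (∀ ζ, branchPoly ζ ≠ 0 → ContinuousAt m ζ) ∧
    ∀ ζ, branchPoly ζ ≠ 0 → surfW ζ = branchPoly ζ * m ζ ^ 2 := by
  refine ⟨fun ζ => ‖ζ‖ / ζ * exp (Complex.log (surfW ζ / branchAux ζ) / 2), fun ζ hζ => ?_,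
    fun ζ hζ => ?_⟩
  · have h1 : ζ ≠ 0 := (mul_ne_zero_iff.1 hζ).1
    have h2 : ContinuousAt (fun ζ => surfW ζ / branchAux ζ) ζ :=
      continuous_surfW.continuousAt.div continuous_branchAux.continuousAt (branchAux_ne_zero hζ)
    have h3 := h2.clog (Complex.mem_slitPlane_iff.2 (Or.inl (re_surfW_div_pos hζ)))
    have h4 : ContinuousAt (fun ζ : ℂ => (‖ζ‖ / ζ : ℂ)) ζ :=
      ContinuousAt.div (by fun_prop) continuousAt_id h1
    exact h4.mul (h3.div_const 2).cexp
  · have h1 : ζ ≠ 0 := (mul_ne_zero_iff.1 hζ).1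
    have h2 : surfW ζ / branchAux ζ ≠ 0 := div_ne_zero (surfW_ne_zero hζ) (branchAux_ne_zero hζ)
    rw [mul_pow, ← Complex.exp_nat_mul]
    push_cast
    rw [mul_div_cancel₀ _ two_ne_zero, Complex.exp_log h2, branchPoly]
    have h3 := branchAux_ne_zero hζ
    have h4 := mul_branchAux ζ
    field_simp
    linear_combination surfW ζ * h4

theorem exists_sq_mul_surfW (h : ℂ ≃ₜ ℂ) (h0 : h 0 = 0) (h1 : h 1 = 1) (h2 : h (-1) = -1) :
    ∃ M : ℂ → ℂ, (∀ ζ, branchPoly ζ ≠ 0 → ContinuousAt M ζ) ∧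
      ∀ ζ, branchPoly ζ ≠ 0 → M ζ ^ 2 * surfW ζ = surfW (h ζ) := by
  obtain ⟨m, hm, hm'⟩ := exists_surfW_eq_mul_sq
  obtain ⟨u, hu, hu'⟩ := exists_sq_eq_div h h0
  obtain ⟨v, hv, hv'⟩ := exists_sq_eq_div h h1
  obtain ⟨w, hw, hw'⟩ := exists_sq_eq_div h h2
  have hb : ∀ ζ, branchPoly ζ ≠ 0 ↔ ζ ≠ 0 ∧ ζ ≠ 1 ∧ ζ ≠ -1 := fun ζ => by
    rw [Ne, branchPoly_eq_zero]
    tauto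
  have hne : ∀ ζ, branchPoly ζ ≠ 0 → branchPoly (h ζ) ≠ 0 := fun ζ hζ => by
    rw [hb] at hζ ⊢
    exact ⟨fun e => hζ.1 (h.injective (e.trans h0.symm)),
      fun e => hζ.2.1 (h.injective (e.trans h1.symm)),
      fun e => hζ.2.2 (h.injective (e.trans h2.symm))⟩
  have hm0 : ∀ ζ, branchPoly ζ ≠ 0 → m ζ ≠ 0 := fun ζ hζ e => surfW_ne_zero hζ (by
    rw [hm' ζ hζ, e]
    ring)
  refine ⟨fun ζ => u ζ * v ζ * w ζ * m (h ζ) / m ζ, fun ζ hζ => ?_, fun ζ hζ => ?_⟩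
  · obtain ⟨k0, k1, k2⟩ := (hb ζ).1 hζ
    exact ((((hu ζ k0).mul (hv ζ k1)).mul (hw ζ k2)).mul
      (ContinuousAt.comp (x := ζ) (hm _ (hne ζ hζ)) h.continuous.continuousAt)).div (hm ζ hζ)
      (hm0 ζ hζ)
  · obtain ⟨k0, k1, k2⟩ := (hb ζ).1 hζ
    have k1' := sub_ne_zero.2 k1
    have k2' := sub_ne_zero.2 k2
    have k3 := hm0 ζ hζ
    rw [hm' ζ hζ, hm' _ (hne ζ hζ), div_pow, mul_pow, mul_pow, mul_pow, hu' ζ k0, hv' ζ k1,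
      hw' ζ k2, branchPoly, branchPoly, sub_zero, sub_zero]
    field_simp
    ring

end Branch

section Lift

open Complex (exp I)

/-- Membership in the lattice `2πℤ + 2πiℤ`. -/
def IsLat (z : ℂ) : Prop := Real.cos z.re = 1 ∧ Real.cos z.im = 1

/-- The branched covering of the extended plane by the plane, with the lattice mapped to infinity. -/
noncomputable def pillow (z : ℂ) : ℂ :=
  surfProj (Real.cos z.re) (Real.cos z.im) (√2 * (Real.sin z.re * Real.sin z.im))

/-- The square root of `surfW` along `pillow`. -/
noncomputable def sinPair (z : ℂ) : ℂ := ⟨Real.sin z.re, Real.sin z.im⟩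

lemma continuous_sinPair : Continuous sinPair := by
  unfold sinPair
  simp only [Complex.mk_eq_add_mul_I]
  fun_prop

lemma isClosed_isLat : IsClosed {z | IsLat z} :=
  (isClosed_eq (by fun_prop) continuous_const).inter (isClosed_eq (by fun_prop) continuous_const)

lemma eventually_not_isLat {z : ℂ} (hz : ¬IsLat z) : ∀ᶠ w in 𝓝 z, ¬IsLat w :=
  isClosed_isLat.isOpen_compl.mem_nhds hz

lemma surfE_relation (x y : ℝ) : (√2 * (Real.sin x * Real.sin y)) ^ 2 =
    2 * (1 - Real.cos x ^ 2) * (1 - Real.cos y ^ 2) := by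
  rw [mul_pow, mul_pow, Real.sq_sqrt zero_le_two, ← Real.sin_sq, ← Real.sin_sq]
  ring

lemma surf_pillow {z : ℂ} (hz : ¬IsLat z) : surfC (pillow z) = Real.cos z.re ∧
    surfD (pillow z) = Real.cos z.im ∧ surfE (pillow z) = √2 * (Real.sin z.re * Real.sin z.im) :=
  surf_surfProj (Real.cos_sq_le_one _) (Real.cos_sq_le_one _) hz (surfE_relation _ _)

lemma pillow_eq_of_surf {z ζ : ℂ} (h1 : surfC ζ = Real.cos z.re) (h2 : surfD ζ = Real.cos z.im)
    (h3 : surfE ζ = √2 * (Real.sin z.re * Real.sin z.im)) : pillow z = ζ := by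
  rw [pillow, ← h1, ← h2, ← h3, surfProj_surf]

lemma continuousAt_pillow {z : ℂ} (hz : ¬IsLat z) : ContinuousAt pillow z := by
  have h0 := (sub_pos.2 (add_lt_sqrt (Real.cos_sq_le_one z.re) (Real.cos_sq_le_one z.im) hz)).ne'
  have h1 : ContinuousAt (fun z : ℂ => (Real.cos z.im - Real.cos z.re) /
      (√(2 + 2 * Real.cos z.re ^ 2 * Real.cos z.im ^ 2) - (Real.cos z.re + Real.cos z.im))) z :=
    ContinuousAt.div (by fun_prop) (by fun_prop) h0
  have h2 : ContinuousAt (fun z : ℂ => √2 * (Real.sin z.re * Real.sin z.im) /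
      (√(2 + 2 * Real.cos z.re ^ 2 * Real.cos z.im ^ 2) - (Real.cos z.re + Real.cos z.im))) z :=
    ContinuousAt.div (by fun_prop) (by fun_prop) h0
  unfold pillow surfProj
  simp only [Complex.mk_eq_add_mul_I]
  exact (Complex.continuous_ofReal.continuousAt.comp h1).add
    ((Complex.continuous_ofReal.continuousAt.comp h2).mul continuousAt_const)

lemma tendsto_pillow_isLat {z : ℂ} (hz : IsLat z) :
    Tendsto pillow (𝓝[{z | ¬IsLat z}] z) (cocompact ℂ) := by
  have h1 : Tendsto (fun w : ℂ => √(2 + 2 * Real.cos w.re ^ 2 * Real.cos w.im ^ 2) +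
      (Real.cos w.re + Real.cos w.im)) (𝓝[{z | ¬IsLat z}] z) (𝓝 4) := by
    refine Tendsto.mono_left ?_ nhdsWithin_le_nhds
    have h : Continuous fun w : ℂ => √(2 + 2 * Real.cos w.re ^ 2 * Real.cos w.im ^ 2) +
      (Real.cos w.re + Real.cos w.im) := by fun_prop
    convert h.tendsto z using 2
    rw [hz.1, hz.2, show (2 + 2 * 1 ^ 2 * 1 ^ 2 : ℝ) = 2 ^ 2 by norm_num,
      Real.sqrt_sq zero_le_two]
    norm_num
  have h2 : Tendsto (fun w : ℂ => √(2 + 2 * Real.cos w.re ^ 2 * Real.cos w.im ^ 2) -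
      (Real.cos w.re + Real.cos w.im)) (𝓝[{z | ¬IsLat z}] z) (𝓝[>] 0) := by
    refine tendsto_nhdsWithin_iff.2 ⟨Tendsto.mono_left ?_ nhdsWithin_le_nhds, ?_⟩
    · have h : Continuous fun w : ℂ => √(2 + 2 * Real.cos w.re ^ 2 * Real.cos w.im ^ 2) -
        (Real.cos w.re + Real.cos w.im) := by fun_prop
      convert h.tendsto z using 2
      rw [hz.1, hz.2, show (2 + 2 * 1 ^ 2 * 1 ^ 2 : ℝ) = 2 ^ 2 by norm_num,
        Real.sqrt_sq zero_le_two]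
      norm_num
    · filter_upwards [self_mem_nhdsWithin] with w hw
      exact sub_pos.2 (add_lt_sqrt (Real.cos_sq_le_one _) (Real.cos_sq_le_one _) hw)
  have h3 := h1.pos_mul_atTop four_pos h2.inv_tendsto_nhdsGT_zero
  rw [← Metric.cobounded_eq_cocompact, ← tendsto_norm_atTop_iff_cobounded]
  have h4 : Tendsto (fun w => ‖pillow w‖ ^ 2) (𝓝[{z | ¬IsLat z}] z) atTop := by
    refine h3.congr' ?_
    filter_upwards [self_mem_nhdsWithin] with w hw
    rw [Complex.sq_norm, Complex.normSq_apply, ← pow_two, ← pow_two, pillow,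
      normSq_surfProj (Real.cos_sq_le_one _) (Real.cos_sq_le_one _) hw (surfE_relation _ _),
      div_eq_mul_inv]
    rfl
  have h5 := Real.tendsto_sqrt_atTop.comp h4
  refine h5.congr fun w => ?_
  simp [Real.sqrt_sq]

lemma surfW_pillow {z : ℂ} (hz : ¬IsLat z) : surfW (pillow z) = sinPair z ^ 2 := by
  obtain ⟨h1, h2, h3⟩ := surf_pillow hz
  have h4 : √2 * √2 = 2 := Real.mul_self_sqrt zero_le_two
  rw [surfW, h1, h2, h3, Real.cos_sq', Real.cos_sq', ← mul_assoc, h4]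
  apply Complex.ext
  · simp [sinPair, pow_two]
  · simp [sinPair, pow_two]
    ring

lemma branchPoly_pillow {z : ℂ} (hz : ¬IsLat z) : branchPoly (pillow z) = 0 ↔ sinPair z = 0 := by
  rw [← surfW_eq_zero, surfW_pillow hz, pow_eq_zero_iff two_ne_zero]

lemma sinPair_of_isLat {z : ℂ} (hz : IsLat z) : sinPair z = 0 := by
  have h1 := Real.sin_sq_add_cos_sq z.re
  have h2 := Real.sin_sq_add_cos_sq z.im
  rw [hz.1] at h1
  rw [hz.2] at h2
  apply Complex.ext
  · exact pow_eq_zero_iff two_ne_zero |>.1 (by linarith : Real.sin z.re ^ 2 = 0)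
  · exact pow_eq_zero_iff two_ne_zero |>.1 (by linarith : Real.sin z.im ^ 2 = 0)

open Classical in
lemma continuous_ite_pillow {F : Type*} [TopologicalSpace F] {T : ℂ → F} (hT : Continuous T) {l : F}
    (hl : Tendsto T (cocompact ℂ) (𝓝 l)) (h : ℂ ≃ₜ ℂ) :
    Continuous fun z => if IsLat z then l else T (h (pillow z)) := by
  rw [continuous_iff_continuousAt]
  intro z
  by_cases hz : IsLat z
  · rw [ContinuousAt, if_pos hz]
    have h1 : Tendsto (fun z => T (h (pillow z))) (𝓝[{z | ¬IsLat z}] z) (𝓝 l) :=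
      hl.comp (h.isClosedEmbedding.tendsto_cocompact.comp (tendsto_pillow_isLat hz))
    rw [tendsto_def] at h1 ⊢
    intro s hs
    have h2 := h1 s hs
    rw [mem_nhdsWithin_iff_eventually] at h2
    filter_upwards [h2] with w hw
    by_cases hw' : IsLat w
    · simpa [hw'] using mem_of_mem_nhds hs
    · simpa [hw'] using hw hw'
  · refine ContinuousAt.congr (f := fun z => T (h (pillow z))) ?_ ?_
    · exact (hT.comp h.continuous).continuousAt.comp (continuousAt_pillow hz)
    · filter_upwards [eventually_not_isLat hz] with w hw
      rw [if_neg hw]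

lemma exists_angle {A S : ℂ → ℝ} (hA : Continuous A) (hS : Continuous S)
    (h : ∀ z, A z ^ 2 + S z ^ 2 = 1) :
    ∃ θ : ℂ → ℝ, Continuous θ ∧ ∀ z, Real.cos (θ z) = A z ∧ Real.sin (θ z) = S z := by
  have hn : ∀ z, ‖(A z + S z * I : ℂ)‖ = 1 := fun z => by
    rw [Complex.norm_add_mul_I, h, Real.sqrt_one]
  obtain ⟨f, hf, hf'⟩ := exists_continuous_exp_eq (g := fun z => (A z + S z * I : ℂ)) (by fun_prop)
    (fun z h0 => by simpa [h0] using hn z)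
  refine ⟨fun z => (f z).im, by fun_prop, fun z => ?_⟩
  have h1 : Real.exp (f z).re = 1 := by rw [← Complex.norm_exp, hf', hn]
  have h2 := congrArg Complex.re (hf' z)
  have h3 := congrArg Complex.im (hf' z)
  rw [Complex.exp_re, h1] at h2
  rw [Complex.exp_im, h1] at h3
  simpa using And.intro h2 h3

lemma sq_add_sq_eq_one_of_relations {A B F s t : ℝ} (hA : A ^ 2 ≤ 1) (hB : B ^ 2 ≤ 1)
    (h1 : s ^ 2 - t ^ 2 = B ^ 2 - A ^ 2) (h2 : 2 * (s * t) = √2 * F)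
    (h3 : F ^ 2 = 2 * (1 - A ^ 2) * (1 - B ^ 2)) : A ^ 2 + s ^ 2 = 1 ∧ B ^ 2 + t ^ 2 = 1 := by
  have h4 : √2 ^ 2 = 2 := Real.sq_sqrt zero_le_two
  have h5 : (s ^ 2 + t ^ 2) ^ 2 = (2 - A ^ 2 - B ^ 2) ^ 2 := by
    have h6 : (2 * (s * t)) ^ 2 = 2 * (2 * (1 - A ^ 2) * (1 - B ^ 2)) := by
      rw [h2, mul_pow, h4, h3]
    linear_combination h6 + (s ^ 2 - t ^ 2 + B ^ 2 - A ^ 2) * h1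
  have h6 := (pow_left_inj₀ (by positivity) (by linarith) two_ne_zero).1 h5
  constructor <;> linarith

/-- A homeomorphism, together with a square root of its effect on `surfW`, lifts to a continuous
self-map of the plane. -/
theorem exists_pillow_lift (h : ℂ ≃ₜ ℂ) (hb : ∀ ζ, branchPoly ζ = 0 → branchPoly (h ζ) = 0)
    {M : ℂ → ℂ} (hM : ∀ ζ, branchPoly ζ ≠ 0 → ContinuousAt M ζ)
    (hM' : ∀ ζ, branchPoly ζ ≠ 0 → M ζ ^ 2 * surfW ζ = surfW (h ζ)) :
    ∃ H : ℂ → ℂ, Continuous H ∧ (∀ z, IsLat z → IsLat (H z)) ∧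
      (∀ z, ¬IsLat z → ¬IsLat (H z)) ∧ (∀ z, ¬IsLat z → pillow (H z) = h (pillow z)) ∧
      ∀ z, ¬IsLat z → sinPair (H z) = sinPair z * M (pillow z) := by
  classical
  let A : ℂ → ℝ := fun z => if IsLat z then 1 else surfC (h (pillow z))
  let B : ℂ → ℝ := fun z => if IsLat z then 1 else surfD (h (pillow z))
  let F : ℂ → ℝ := fun z => if IsLat z then 0 else surfE (h (pillow z))
  obtain ⟨hCl, hDl, hEl⟩ := tendsto_surf_cocompact
  have hA : Continuous A := continuous_ite_pillow continuous_surfC hCl h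
  have hB : Continuous B := continuous_ite_pillow continuous_surfD hDl h
  have hF : Continuous F := continuous_ite_pillow continuous_surfE hEl h
  let Y : ℂ → ℂ := fun z => if IsLat z then 0 else sinPair z * M (pillow z)
  let W : ℂ → ℂ := fun z => ⟨B z ^ 2 - A z ^ 2, √2 * F z⟩
  have hW : Continuous W := by
    simp only [W, Complex.mk_eq_add_mul_I]
    fun_prop
  have hYW : ∀ z, Y z ^ 2 = W z := by
    intro z
    by_cases hz : IsLat z
    · simp only [Y, W, A, B, F, if_pos hz]
      apply Complex.ext <;> simp
    · simp only [Y, W, A, B, F, if_neg hz]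
      change _ = surfW (h (pillow z))
      by_cases h0 : branchPoly (pillow z) = 0
      · rw [(branchPoly_pillow hz).1 h0, surfW_eq_zero_of_branchPoly (hb _ h0)]
        ring
      · rw [← hM' _ h0, surfW_pillow hz]
        ring
  have hY : Continuous Y := by
    rw [continuous_iff_continuousAt]
    intro z
    by_cases h0 : W z = 0
    · have h1 : Y z = 0 := pow_eq_zero_iff two_ne_zero |>.1 ((hYW z).trans h0)
      rw [ContinuousAt, h1, tendsto_zero_iff_norm_tendsto_zero]
      have h2 : Continuous fun z => √‖W z‖ := by fun_prop
      have h3 := h2.tendsto z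
      rw [h0, norm_zero, Real.sqrt_zero] at h3
      refine h3.congr fun w => ?_
      rw [← hYW, norm_pow, Real.sqrt_sq (norm_nonneg _)]
    · have hz : ¬IsLat z := fun hz => h0 (by
        rw [← hYW]
        simp [Y, hz])
      have h1 : branchPoly (pillow z) ≠ 0 := fun h1 => h0 (by
        rw [← hYW]
        simp [Y, (branchPoly_pillow hz).1 h1])
      refine ContinuousAt.congr (f := fun z => sinPair z * M (pillow z)) ?_ ?_
      · exact continuous_sinPair.continuousAt.mul
          (ContinuousAt.comp (x := z) (hM _ h1) (continuousAt_pillow hz))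
      · filter_upwards [eventually_not_isLat hz] with w hw
        exact (if_neg hw).symm
  have hrel : ∀ z, A z ^ 2 + (Y z).re ^ 2 = 1 ∧ B z ^ 2 + (Y z).im ^ 2 = 1 := by
    intro z
    have h0 := hYW z
    have h1 := congrArg Complex.re h0
    have h2 := congrArg Complex.im h0
    rw [pow_two] at h1 h2
    simp only [Complex.mul_re, Complex.mul_im, W] at h1 h2
    have h3 : A z ^ 2 ≤ 1 ∧ B z ^ 2 ≤ 1 ∧ F z ^ 2 = 2 * (1 - A z ^ 2) * (1 - B z ^ 2) := by
      by_cases hz : IsLat z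
      · simp [A, B, F, hz]
      · simp only [A, B, F, if_neg hz]
        exact ⟨(surf_sq_le_one _).1, (surf_sq_le_one _).2, surfE_sq _⟩
    exact sq_add_sq_eq_one_of_relations h3.1 h3.2.1 (by linarith) (by linarith) h3.2.2
  obtain ⟨θ, hθ, hθ'⟩ := exists_angle hA (Complex.continuous_re.comp hY) fun z => (hrel z).1
  obtain ⟨φ, hφ, hφ'⟩ := exists_angle hB (Complex.continuous_im.comp hY) fun z => (hrel z).2
  have hAz : ∀ z, ¬IsLat z → A z = surfC (h (pillow z)) := fun z hz => if_neg hz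
  have hBz : ∀ z, ¬IsLat z → B z = surfD (h (pillow z)) := fun z hz => if_neg hz
  have hFz : ∀ z, ¬IsLat z → F z = surfE (h (pillow z)) := fun z hz => if_neg hz
  refine ⟨fun z => ⟨θ z, φ z⟩, ?_, fun z hz => ?_, fun z hz => ?_, fun z hz => ?_, fun z hz => ?_⟩
  · simp only [Complex.mk_eq_add_mul_I]
    fun_prop
  · exact ⟨(hθ' z).1.trans (if_pos hz), (hφ' z).1.trans (if_pos hz)⟩
  · rintro ⟨h1, h2⟩
    simp only at h1 h2
    rw [(hθ' z).1, hAz z hz] at h1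
    rw [(hφ' z).1, hBz z hz] at h2
    exact surf_ne_one _ ⟨h1, h2⟩
  · refine pillow_eq_of_surf ?_ ?_ ?_
    · rw [(hθ' z).1, hAz z hz]
    · rw [(hφ' z).1, hBz z hz]
    · rw [(hθ' z).2, (hφ' z).2, ← hFz z hz]
      have h2 := congrArg Complex.im (hYW z)
      rw [pow_two, Complex.mul_im] at h2
      simp only [Function.comp, W] at h2 ⊢
      have h4 : √2 * √2 = 2 := Real.mul_self_sqrt zero_le_two
      have h5 : √2 ≠ 0 := by positivity
      refine mul_left_cancel₀ h5 ?_
      rw [← h2, ← mul_assoc, h4]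
      ring
  · have h1 : Y z = sinPair z * M (pillow z) := if_neg hz
    rw [← h1]
    exact Complex.ext (hθ' z).2 (hφ' z).2

end Lift

section LiftHomeo

/-- The cosines of both coordinates. -/
noncomputable def cosPair (z : ℂ) : ℂ := ⟨Real.cos z.re, Real.cos z.im⟩

lemma cosPair_eq_iff {z w : ℂ} : cosPair z = cosPair w ↔
    Real.cos z.re = Real.cos w.re ∧ Real.cos z.im = Real.cos w.im := Complex.ext_iff

lemma sinPair_eq_iff {z w : ℂ} : sinPair z = sinPair w ↔
    Real.sin z.re = Real.sin w.re ∧ Real.sin z.im = Real.sin w.im := Complex.ext_iff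

lemma isLat_congr {z w : ℂ} (hc : cosPair z = cosPair w) : IsLat z ↔ IsLat w := by
  rw [IsLat, IsLat, (cosPair_eq_iff.1 hc).1, (cosPair_eq_iff.1 hc).2]

lemma pillow_congr {z w : ℂ} (hc : cosPair z = cosPair w) (hs : sinPair z = sinPair w) :
    pillow z = pillow w := by
  rw [pillow, pillow, (cosPair_eq_iff.1 hc).1, (cosPair_eq_iff.1 hc).2, (sinPair_eq_iff.1 hs).1,
    (sinPair_eq_iff.1 hs).2]

lemma cosPair_eq_of_pillow_eq {z w : ℂ} (hz : ¬IsLat z) (hw : ¬IsLat w)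
    (h : pillow z = pillow w) : cosPair z = cosPair w := by
  obtain ⟨h1, h2, -⟩ := surf_pillow hz
  obtain ⟨h3, h4, -⟩ := surf_pillow hw
  refine Complex.ext ?_ ?_
  · change Real.cos z.re = Real.cos w.re
    rw [← h1, ← h3, h]
  · change Real.cos z.im = Real.cos w.im
    rw [← h2, ← h4, h]

lemma cosPair_eq_of_isLat {z w : ℂ} (hz : IsLat z) (hw : IsLat w) : cosPair z = cosPair w :=
  Complex.ext (hz.1.trans hw.1.symm) (hz.2.trans hw.2.symm)

lemma exists_eq_add_of_trig_eq {f g : ℂ → ℂ} (hf : Continuous f) (hg : Continuous g)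
    (hc : ∀ z, cosPair (f z) = cosPair (g z)) (hs : ∀ z, sinPair (f z) = sinPair (g z)) :
    ∃ c, ∀ z, f z = g z + c := by
  have key : ∀ {u v : ℝ}, Real.cos u = Real.cos v → Real.sin u = Real.sin v →
      ∃ n : ℤ, (u - v) / (2 * Real.pi) = n := fun h1 h2 => by
    obtain ⟨n, hn⟩ := Real.Angle.angle_eq_iff_two_pi_dvd_sub.1 (Real.Angle.cos_sin_inj h1 h2)
    exact ⟨n, by rw [hn, mul_div_cancel_left₀ _ Real.two_pi_pos.ne']⟩
  obtain ⟨m, hm⟩ := exists_eq_intCast_of_continuous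
    (f := fun z => ((f z).re - (g z).re) / (2 * Real.pi)) (by fun_prop)
    fun z => key (cosPair_eq_iff.1 (hc z)).1 (sinPair_eq_iff.1 (hs z)).1
  obtain ⟨n, hn⟩ := exists_eq_intCast_of_continuous
    (f := fun z => ((f z).im - (g z).im) / (2 * Real.pi)) (by fun_prop)
    fun z => key (cosPair_eq_iff.1 (hc z)).2 (sinPair_eq_iff.1 (hs z)).2
  refine ⟨⟨m * (2 * Real.pi), n * (2 * Real.pi)⟩, fun z => Complex.ext ?_ ?_⟩
  · have := (div_eq_iff Real.two_pi_pos.ne').1 (hm z)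
    rw [Complex.add_re]
    linarith
  · have := (div_eq_iff Real.two_pi_pos.ne').1 (hn z)
    rw [Complex.add_im]
    linarith

/-- A map which becomes invertible up to translations on both sides is a homeomorphism. -/
lemma exists_homeo_of_comp_eq_add {H K : ℂ → ℂ} (hH : Continuous H) (hK : Continuous K) {a b : ℂ}
    (ha : ∀ z, K (H z) = z + a) (hb : ∀ z, H (K z) = z + b) : ∃ f : ℂ ≃ₜ ℂ, ⇑f = H := by
  have h1 : ∀ z, H (K (z - b)) = z := fun z => by rw [hb, sub_add_cancel]
  refine ⟨mkHomeo H (fun z => K (z - b)) hH (by fun_prop) (fun z => ?_) h1, rfl⟩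
  have h2 := ha (K (H z - b))
  rw [h1, ha] at h2
  exact (add_right_cancel h2).symm

/-- The composite of a lift of `h` and a lift of its inverse is a translation. -/
lemma exists_comp_eq_add {h k : ℂ ≃ₜ ℂ} (hkh : ∀ ζ, k (h ζ) = ζ)
    {M N : ℂ → ℂ} (hMN : ∀ ζ, branchPoly ζ ≠ 0 → M ζ * N (h ζ) = 1) {H K : ℂ → ℂ}
    (hH : Continuous H) (hK : Continuous K) (hH1 : ∀ z, IsLat z → IsLat (H z))
    (hK1 : ∀ z, IsLat z → IsLat (K z)) (hH2 : ∀ z, ¬IsLat z → ¬IsLat (H z))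
    (hK2 : ∀ z, ¬IsLat z → ¬IsLat (K z)) (hH3 : ∀ z, ¬IsLat z → pillow (H z) = h (pillow z))
    (hK3 : ∀ z, ¬IsLat z → pillow (K z) = k (pillow z))
    (hH4 : ∀ z, ¬IsLat z → sinPair (H z) = sinPair z * M (pillow z))
    (hK4 : ∀ z, ¬IsLat z → sinPair (K z) = sinPair z * N (pillow z)) :
    ∃ a, ∀ z, K (H z) = z + a := by
  refine exists_eq_add_of_trig_eq (hK.comp hH) continuous_id (fun z => ?_) fun z => ?_
  · by_cases hz : IsLat z
    · exact cosPair_eq_of_isLat (hK1 _ (hH1 _ hz)) hz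
    · refine cosPair_eq_of_pillow_eq (hK2 _ (hH2 _ hz)) hz ?_
      rw [hK3 _ (hH2 _ hz), hH3 _ hz, hkh]
  · by_cases hz : IsLat z
    · exact (sinPair_of_isLat (hK1 _ (hH1 _ hz))).trans (sinPair_of_isLat hz).symm
    · rw [hK4 _ (hH2 _ hz), hH4 _ hz, hH3 _ hz, mul_assoc]
      by_cases hs : sinPair z = 0
      · rw [hs, zero_mul]
      · rw [hMN _ (mt (branchPoly_pillow hz).1 hs), mul_one]

/-- A homeomorphism fixing the branch points lifts to a homeomorphism with constant increments
along the period lattice. -/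
theorem exists_pillow_lift_homeo (h : ℂ ≃ₜ ℂ) (h0 : h 0 = 0) (h1 : h 1 = 1) (h2 : h (-1) = -1) :
    ∃ H : ℂ ≃ₜ ℂ, (∀ p, (∀ z, cosPair (z + p) = cosPair z) → (∀ z, sinPair (z + p) = sinPair z) →
      ∃ c, ∀ z, H (z + p) = H z + c) ∧
      ∀ z, ¬IsLat z → ¬IsLat (H z) ∧ pillow (H z) = h (pillow z) := by
  have hb : ∀ ζ, branchPoly ζ = 0 → h ζ = ζ := fun ζ hζ => by
    rcases branchPoly_eq_zero.1 hζ with rfl | rfl | rfl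
    exacts [h0, h1, h2]
  have hb' : ∀ ζ, branchPoly ζ = 0 → h.symm ζ = ζ := fun ζ hζ => by
    rw [h.symm_apply_eq, hb ζ hζ]
  have hb'' : ∀ ζ, branchPoly ζ ≠ 0 → branchPoly (h.symm ζ) ≠ 0 := fun ζ hζ h0 =>
    hζ (by rw [← h.apply_symm_apply ζ, hb _ h0]; exact h0)
  have hb3 : ∀ ζ, branchPoly ζ ≠ 0 → branchPoly (h ζ) ≠ 0 := fun ζ hζ h0 =>
    hζ (by rw [← h.symm_apply_apply ζ, hb' _ h0]; exact h0)
  obtain ⟨M, hM, hM'⟩ := exists_sq_mul_surfW h h0 h1 h2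
  have hM0 : ∀ ζ, branchPoly ζ ≠ 0 → M ζ ≠ 0 := fun ζ hζ hm => by
    have := hM' ζ hζ
    rw [hm, zero_pow two_ne_zero, zero_mul] at this
    exact hb3 ζ hζ (surfW_eq_zero.1 this.symm)
  obtain ⟨H, hH, hH1, hH2, hH3, hH4⟩ :=
    exists_pillow_lift h (fun ζ hζ => by rwa [hb ζ hζ]) hM hM'
  obtain ⟨K, hK, hK1, hK2, hK3, hK4⟩ :=
    exists_pillow_lift h.symm (fun ζ hζ => by rwa [hb' ζ hζ]) (M := fun ζ => (M (h.symm ζ))⁻¹)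
      (fun ζ hζ => ((hM _ (hb'' ζ hζ)).comp h.symm.continuous.continuousAt).inv₀
        (hM0 _ (hb'' ζ hζ)))
      (fun ζ hζ => by
        have h3 := hM' _ (hb'' ζ hζ)
        rw [h.apply_symm_apply] at h3
        rw [← h3, ← mul_assoc, ← mul_pow, inv_mul_cancel₀ (hM0 _ (hb'' ζ hζ)), one_pow, one_mul])
  obtain ⟨a, ha⟩ := exists_comp_eq_add h.symm_apply_apply
    (N := fun ζ => (M (h.symm ζ))⁻¹) (fun ζ hζ => by rw [h.symm_apply_apply, mul_inv_cancel₀ (hM0 ζ hζ)])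
    hH hK hH1 hK1 hH2 hK2 hH3 hK3 hH4 hK4
  obtain ⟨b, hb⟩ := exists_comp_eq_add h.apply_symm_apply
    (fun ζ hζ => inv_mul_cancel₀ (hM0 _ (hb'' ζ hζ)))
    hK hH hK1 hH1 hK2 hH2 hK3 hH3 hK4 hH4
  obtain ⟨f, hf⟩ := exists_homeo_of_comp_eq_add hH hK ha hb
  refine ⟨f, fun p hc hs => ?_, fun z hz => by rw [hf]; exact ⟨hH2 z hz, hH3 z hz⟩⟩
  rw [hf]
  refine exists_eq_add_of_trig_eq (f := fun z => H (z + p)) (by fun_prop) hH (fun z => ?_)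
    fun z => ?_
  · by_cases hz : IsLat z
    · exact cosPair_eq_of_isLat (hH1 _ ((isLat_congr (hc z)).2 hz)) (hH1 _ hz)
    · have hz' := mt (isLat_congr (hc z)).1 hz
      refine cosPair_eq_of_pillow_eq (hH2 _ hz') (hH2 _ hz) ?_
      rw [hH3 _ hz', hH3 _ hz, pillow_congr (hc z) (hs z)]
  · by_cases hz : IsLat z
    · exact (sinPair_of_isLat (hH1 _ ((isLat_congr (hc z)).2 hz))).trans
        (sinPair_of_isLat (hH1 _ hz)).symm
    · have hz' := mt (isLat_congr (hc z)).1 hz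
      change sinPair (H (z + p)) = _
      rw [hH4 _ hz', hH4 _ hz, pillow_congr (hc z) (hs z), hs]

end LiftHomeo

section Increments

lemma exists_norm_le_of_periodic {G : ℂ → ℂ} (hG : Continuous G) {T : ℝ} (hT : 0 < T)
    (h1 : Function.Periodic G ⟨T, 0⟩) (h2 : Function.Periodic G ⟨0, T⟩) :
    ∃ C, ∀ z, ‖G z‖ ≤ C := by
  obtain ⟨C, hC⟩ := ((isCompact_Icc.reProdIm isCompact_Icc : IsCompact
    (Icc 0 T ×ℂ Icc 0 T)).image hG).isBounded.exists_norm_le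
  refine ⟨C, fun z => ?_⟩
  rw [← h1.sub_zsmul_eq ⌊z.re / T⌋, ← h2.sub_zsmul_eq ⌊z.im / T⌋]
  refine hC _ ⟨_, ?_, rfl⟩
  have key : ∀ x : ℝ, x - ⌊x / T⌋ * T ∈ Icc 0 T := fun x =>
    ⟨by linarith [(le_div_iff₀ hT).1 (Int.floor_le (x / T))],
      by linarith [(div_lt_iff₀ hT).1 (Int.lt_floor_add_one (x / T))]⟩
  rw [Complex.mem_reProdIm]
  exact ⟨by simpa using key z.re, by simpa using key z.im⟩

lemma mk_eq_mk_of_norm_sub_le {f g : ℂ ≃ₜ ℂ} {C : ℝ} (h : ∀ z, ‖f z - g z‖ ≤ C) :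
    (QuotientGroup.mk f : (ℂ ≃ₜ ℂ) ⧸ tame ℂ) = QuotientGroup.mk g := by
  have h1 : f * g⁻¹ ∈ tame ℂ := isTame_of_norm_sub_le (C := C) fun x => by
    have := h (g⁻¹ x)
    rwa [app_inv_self] at this
  rw [eq_comm, QuotientGroup.eq]
  exact (Subgroup.Normal.mem_comm_iff inferInstance).1 h1

theorem exists_mk_eq_mk_diagHomeo_of_increments {H : ℂ ≃ₜ ℂ} {T : ℝ} (hT : 0 < T) {c d : ℂ}
    (hc : ∀ z, H (z + ⟨T, 0⟩) = H z + c) (hd : ∀ z, H (z + ⟨0, T⟩) = H z + d) :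
    ∃ s t : ℝˣ, (QuotientGroup.mk H : (ℂ ≃ₜ ℂ) ⧸ tame ℂ) = QuotientGroup.mk (diagHomeo s t) := by
  let Λ : ℂ →ₗ[ℝ] ℂ := Complex.reLm.smulRight (T⁻¹ • c) + Complex.imLm.smulRight (T⁻¹ • d)
  have hΛ : ∀ z, Λ z = z.re • T⁻¹ • c + z.im • T⁻¹ • d := fun z => rfl
  have hΛ1 : Λ ⟨T, 0⟩ = c := by simp [hΛ, hT.ne']
  have hΛ2 : Λ ⟨0, T⟩ = d := by simp [hΛ, hT.ne']
  obtain ⟨C, hC⟩ := exists_norm_le_of_periodic (G := fun z => H z - Λ z)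
    (H.continuous.sub Λ.continuous_of_finiteDimensional) hT
    (fun z => by simp only [map_add, hΛ1, hc]; ring) (fun z => by simp only [map_add, hΛ2, hd]; ring)
  have hinj : Function.Injective Λ := by
    rw [injective_iff_map_eq_zero]
    intro v hv
    obtain ⟨R, hR⟩ := exists_norm_le_image H⁻¹ C
    have h1 : ∀ t : ℝ, |t| * ‖v‖ ≤ R := fun t => by
      have h2 : ‖H (t • v) - Λ (t • v)‖ ≤ C := hC (t • v)
      rw [map_smul Λ, hv, smul_zero, sub_zero] at h2
      have h3 := hR _ h2
      rwa [inv_app_self, norm_smul, Real.norm_eq_abs] at h3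
    by_contra h0
    have h4 := h1 ((R + 1) / ‖v‖)
    have h5 := mul_le_mul_of_nonneg_right (le_abs_self ((R + 1) / ‖v‖)) (norm_nonneg v)
    rw [div_mul_cancel₀ _ (norm_ne_zero_iff.2 h0)] at h5
    linarith
  let f : ℂ ≃ₜ ℂ := (LinearEquiv.ofInjectiveEndo Λ hinj).toContinuousLinearEquiv.toHomeomorph
  have hf : ∀ z, f z = Λ z := fun z => rfl
  obtain ⟨s, t, hst⟩ := exists_mk_eq_mk_diagHomeo (f := f) (a := (T⁻¹ • c).re)
    (b := (T⁻¹ • d).re) (c := (T⁻¹ • c).im) (d := (T⁻¹ • d).im) fun z => by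
      rw [hf, hΛ]
      apply Complex.ext
      · simp only [Complex.add_re, Complex.real_smul, Complex.re_ofReal_mul]
        ring
      · simp only [Complex.add_im, Complex.real_smul, Complex.im_ofReal_mul]
        ring
  exact ⟨s, t, (mk_eq_mk_of_norm_sub_le (g := f) hC).trans hst⟩

end Increments

section BasePoint

open Complex (I)

/-- The preimage of `I` under `pillow`. -/
noncomputable def basePt : ℂ := ⟨Real.pi / 2, Real.pi / 2⟩

lemma not_isLat_basePt : ¬IsLat basePt := fun h => by simpa [basePt] using h.1

lemma pillow_basePt : pillow basePt = I := by
  apply Complex.ext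
  · simp [pillow, surfProj, basePt]
  · simp [pillow, surfProj, basePt]

/-- The derivative of `pillow` at `basePt`, as a linear map. -/
noncomputable def pillowDerivLM : ℂ →ₗ[ℝ] ℂ :=
  (√2)⁻¹ • (Complex.reLm.smulRight (1 - I) + Complex.imLm.smulRight (-1 - I))

lemma pillowDerivLM_apply (v : ℂ) :
    pillowDerivLM v = ((√2)⁻¹ : ℝ) • (v.re • (1 - I) + v.im • (-1 - I)) := rfl

lemma pillowDerivLM_injective : Function.Injective pillowDerivLM := by
  rw [injective_iff_map_eq_zero]
  intro v hv
  rw [pillowDerivLM_apply, smul_eq_zero_iff_right (inv_ne_zero (Real.sqrt_ne_zero'.2 zero_lt_two))]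
    at hv
  have h1 := congrArg Complex.re hv
  have h2 := congrArg Complex.im hv
  simp at h1 h2
  exact Complex.ext (by rw [Complex.zero_re]; linarith) (by rw [Complex.zero_im]; linarith)

/-- The derivative of `pillow` at `basePt`. -/
noncomputable def pillowDeriv : ℂ ≃L[ℝ] ℂ :=
  (LinearEquiv.ofInjectiveEndo pillowDerivLM pillowDerivLM_injective).toContinuousLinearEquiv

lemma pillowDeriv_apply (v : ℂ) :
    pillowDeriv v = ((√2)⁻¹ : ℝ) • (v.re • (1 - I) + v.im • (-1 - I)) := rfl

lemma hasStrictFDerivAt_pillow :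
    HasStrictFDerivAt pillow (pillowDeriv : ℂ →L[ℝ] ℂ) basePt := by
  have hx : HasStrictFDerivAt (fun z : ℂ => z.re) Complex.reCLM basePt :=
    Complex.reCLM.hasStrictFDerivAt
  have hy : HasStrictFDerivAt (fun z : ℂ => z.im) Complex.imCLM basePt :=
    Complex.imCLM.hasStrictFDerivAt
  have hD := ((((hx.cos.pow 2).const_mul 2).mul (hy.cos.pow 2)).const_add 2).sqrt (by simp [basePt])
  have hD' := hD.sub (hx.cos.add hy.cos)
  have hi := (hasStrictDerivAt_inv (by simp [basePt])).comp_hasStrictFDerivAt _ hD'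
  have h1 := (hy.cos.sub hx.cos).mul hi
  have h2 := ((hx.sin.mul hy.sin).const_mul √2).mul hi
  have h3 := (Complex.ofRealCLM.hasStrictFDerivAt.comp _ h1).add
    ((Complex.ofRealCLM.hasStrictFDerivAt.comp _ h2).mul_const I)
  refine (h3.congr_fderiv ?_).congr_of_eventuallyEq (Eventually.of_forall fun z => ?_)
  · refine ContinuousLinearMap.ext fun z => ?_
    have h2 : √2 * 2⁻¹ = (√2)⁻¹ := by
      rw [← div_eq_mul_inv, Real.sqrt_div_self', one_div]
    have h2' : (√2 : ℂ) * 2⁻¹ = (√2 : ℂ)⁻¹ := by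
      rw [← Complex.ofReal_inv, ← h2]
      push_cast
      rfl
    have h4 : ((pillowDeriv : ℂ →L[ℝ] ℂ)) z = _ := pillowDeriv_apply z
    rw [h4]
    simp [basePt]
    linear_combination (-I * (z.re + z.im)) * h2'
  · simp [pillow, surfProj, Complex.mk_eq_add_mul_I, div_eq_mul_inv]

end BasePoint

section Abelian

open Complex (I)

lemma exists_homeo_eventuallyEq_pillow : ∃ Q : ℂ ≃ₜ ℂ, ∀ᶠ z in 𝓝 basePt, Q z = pillow z := by
  have hN : 0 < ‖(pillowDeriv.symm : ℂ →L[ℝ] ℂ)‖₊⁻¹ :=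
    inv_pos.2 pillowDeriv.nnnorm_symm_pos
  have hL := lipschitzExtensionConstant_pos ℂ
  obtain ⟨s, hs, hs'⟩ := hasStrictFDerivAt_pillow.approximates_deriv_on_nhds (Or.inr
    (div_pos (half_pos hN) hL))
  obtain ⟨Q, hQ⟩ := hs'.exists_homeomorph_extension (Or.inr (by
    rw [mul_div_cancel₀ _ hL.ne']
    exact half_lt_self hN))
  exact ⟨Q, mem_of_superset hs fun z hz => (hQ hz).symm⟩

/-- The deck transformation of `pillow` moving a preimage `p` of `I` to `basePt`. -/
lemma exists_deck {p : ℂ} (hp : ¬IsLat p) (hp' : pillow p = I) : ∃ (γ : ℂ ≃ₜ ℂ) (ε : ℝ),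
    γ p = basePt ∧ (∀ z, pillow (γ z) = pillow z) ∧ ∀ z w, γ (z + w) = γ z + ε * w := by
  have hpq : pillow p = pillow basePt := hp'.trans pillow_basePt.symm
  obtain ⟨h1, h2⟩ := cosPair_eq_iff.1 (cosPair_eq_of_pillow_eq hp not_isLat_basePt hpq)
  have h3 := (surf_pillow hp).2.2
  rw [hpq, (surf_pillow not_isLat_basePt).2.2] at h3
  simp only [basePt, Real.cos_pi_div_two, Real.sin_pi_div_two] at h1 h2 h3
  have h4 := mul_left_cancel₀ (Real.sqrt_ne_zero'.2 zero_lt_two) h3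
  have h5 := Real.sin_sq_add_cos_sq p.re
  have h6 := Real.sin_sq_add_cos_sq p.im
  rw [h1] at h5
  rw [h2] at h6
  set ε := Real.sin p.re with hε
  have h7 : ε = Real.sin p.im := by
    have : (ε - Real.sin p.im) ^ 2 = 0 := by linear_combination h5 + h6 + 2 * h4
    exact sub_eq_zero.1 (pow_eq_zero_iff two_ne_zero |>.1 this)
  have h8 : ε * ε = 1 := by linear_combination h5
  have h8' : (ε : ℂ) * ε = 1 := by exact_mod_cast h8
  have h9 : ∀ x, Real.sin (ε * x) = ε * Real.sin x ∧ Real.cos (ε * x) = Real.cos x := fun x => by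
    rcases mul_self_eq_one_iff.1 h8 with h | h <;> simp [h]
  have key : ∀ x X, Real.cos X = 0 → Real.sin X = ε →
      Real.cos (ε * (x - X) + Real.pi / 2) = Real.cos x ∧
      Real.sin (ε * (x - X) + Real.pi / 2) = ε * Real.sin x := fun x X hc hs => by
    rw [Real.cos_add_pi_div_two, Real.sin_add_pi_div_two, (h9 _).1, (h9 _).2, Real.sin_sub,
      Real.cos_sub, hc, hs]
    constructor
    · linear_combination Real.cos x * h8
    · ring
  refine ⟨mkHomeo (fun z => ε * (z - p) + basePt) (fun z => ε * (z - basePt) + p) (by fun_prop)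
    (by fun_prop) (fun z => by linear_combination (z - p) * h8')
    (fun z => by linear_combination (z - basePt) * h8'), ε, ?_, fun z => ?_, fun z w => ?_⟩
  · change ε * (p - p) + basePt = basePt
    rw [sub_self, mul_zero, zero_add]
  · change pillow (ε * (z - p) + basePt) = pillow z
    have hre : ((ε : ℂ) * (z - p) + basePt).re = ε * (z.re - p.re) + Real.pi / 2 := by
      simp [basePt]
    have him : ((ε : ℂ) * (z - p) + basePt).im = ε * (z.im - p.im) + Real.pi / 2 := by
      simp [basePt]
    rw [pillow, hre, him, (key z.re p.re h1 rfl).1, (key z.re p.re h1 rfl).2,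
      (key z.im p.im h2 h7.symm).1, (key z.im p.im h2 h7.symm).2, mul_mul_mul_comm, h8, one_mul,
      pillow]
  · change ε * (z + w - p) + basePt = ε * (z - p) + basePt + ε * w
    ring

lemma exists_mul_mk_diagHomeo_of_fixed {Q : ℂ ≃ₜ ℂ} (hQ : ∀ᶠ z in 𝓝 basePt, Q z = pillow z)
    {h : ℂ ≃ₜ ℂ} (h0 : h 0 = 0) (h1 : h 1 = 1) (h2 : h (-1) = -1) (h3 : h I = I) :
    ∃ s t : ℝˣ, (QuotientGroup.mk (h * Q) : (ℂ ≃ₜ ℂ) ⧸ tame ℂ) =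
      QuotientGroup.mk (Q * diagHomeo s t) := by
  obtain ⟨H, hH, hH'⟩ := exists_pillow_lift_homeo h h0 h1 h2
  obtain ⟨hb, hb'⟩ := hH' _ not_isLat_basePt
  rw [pillow_basePt, h3] at hb'
  obtain ⟨γ, ε, hγ, hγ', hγ''⟩ := exists_deck hb hb'
  obtain ⟨c, hc⟩ := hH ⟨2 * Real.pi, 0⟩ (fun z => by simp [cosPair]) fun z => by simp [sinPair]
  obtain ⟨d, hd⟩ := hH ⟨0, 2 * Real.pi⟩ (fun z => by simp [cosPair]) fun z => by simp [sinPair]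
  obtain ⟨s, t, hst⟩ := exists_mk_eq_mk_diagHomeo_of_increments (H := γ * H) Real.two_pi_pos
    (c := ε * c) (d := ε * d) (fun z => by rw [mul_app, hc, hγ'', mul_app])
    (fun z => by rw [mul_app, hd, hγ'', mul_app])
  refine ⟨s, t, ?_⟩
  rw [QuotientGroup.mk_mul (tame ℂ) Q, ← hst, ← QuotientGroup.mk_mul, QuotientGroup.eq]
  have hcont : Tendsto (γ * H) (𝓝 basePt) (𝓝 basePt) := by
    have := (γ * H).continuous.tendsto basePt
    rwa [mul_app, hγ] at this
  refine inv_mul_mem_tame_of_eventuallyEq (p := basePt) ?_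
  filter_upwards [hQ, hcont.eventually hQ, eventually_not_isLat not_isLat_basePt] with z hz hz' hz''
  rw [mul_app, mul_app, hz, hz', mul_app, hγ', (hH' z hz'').2]

theorem exists_mk_eq_conj_mk_diagHomeo : ∃ q : (ℂ ≃ₜ ℂ) ⧸ tame ℂ, ∀ f : ℂ ≃ₜ ℂ,
    ∃ s t : ℝˣ, (QuotientGroup.mk f : (ℂ ≃ₜ ℂ) ⧸ tame ℂ) =
      q * QuotientGroup.mk (diagHomeo s t) * q⁻¹ := by
  obtain ⟨Q, hQ⟩ := exists_homeo_eventuallyEq_pillow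
  refine ⟨QuotientGroup.mk Q, fun f => ?_⟩
  have hr : Function.Injective ![0, 1, -1, I] := by
    intro i j
    fin_cases i <;> fin_cases j <;> simp [Complex.ext_iff] <;> norm_num
  obtain ⟨σ, hσ, hσ'⟩ := exists_mem_tame_apply_eq (f.injective.comp hr) hr
  obtain ⟨s, t, hst⟩ := exists_mul_mk_diagHomeo_of_fixed hQ (h := σ * f) (hσ' 0) (hσ' 1) (hσ' 2)
    (hσ' 3)
  refine ⟨s, t, ?_⟩
  rw [eq_mul_inv_iff_mul_eq, ← QuotientGroup.mk_mul, ← QuotientGroup.mk_mul, ← hst, mul_assoc,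
    QuotientGroup.mk_mul _ σ, (QuotientGroup.eq_one_iff σ).2 hσ, one_mul]

theorem commutator_le_tame : commutator (ℂ ≃ₜ ℂ) ≤ tame ℂ := by
  refine (Subgroup.Normal.quotient_commutative_iff_commutator_le).1 ⟨⟨fun a b => ?_⟩⟩
  obtain ⟨q, hq⟩ := exists_mk_eq_conj_mk_diagHomeo
  obtain ⟨f, rfl⟩ := QuotientGroup.mk_surjective a
  obtain ⟨g, rfl⟩ := QuotientGroup.mk_surjective b
  obtain ⟨s, t, hf⟩ := hq f
  obtain ⟨s', t', hg⟩ := hq g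
  rw [hf, hg, conj_mul, conj_mul, ← QuotientGroup.mk_mul, ← QuotientGroup.mk_mul,
    (commute_diagHomeo s t s' t').eq]

end Abelian

/-- Conjugation by a homeomorphism, as an isomorphism of homeomorphism groups. -/
def conjEquiv {X Y : Type*} [TopologicalSpace X] [TopologicalSpace Y] (e : X ≃ₜ Y) :
    (X ≃ₜ X) ≃* (Y ≃ₜ Y) where
  toFun f := (e.symm.trans f).trans e
  invFun f := (e.trans f).trans e.symm
  left_inv f := by ext; simp
  right_inv f := by ext; simp
  map_mul' f g := by ext; simp

lemma infinite_homeomorph_complex : Infinite (ℂ ≃ₜ ℂ) :=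
  Infinite.of_injective (fun a : ℂ => Homeomorph.addRight a) fun a b h => by
    simpa using DFunLike.congr_fun h 0

end PlaneHomeo

open PlaneHomeo in
/-- Quantitative strong distortion for `Homeo(ℝ²)`: given a sequence `h` in the
commutator subgroup of `Homeo(ℝ²)`, there is a set `S` of cardinality `9` such that
each `h n` is a product of at most `26 n + 12` elements, each lying in `S` or being
an inverse of an element of `S`. -/
theorem homeo_euclideanPlane_quantitative_distortion
    (h : ℕ → (EuclideanSpace ℝ (Fin 2) ≃ₜ EuclideanSpace ℝ (Fin 2)))
    (hmem : ∀ n, h n ∈ commutator (EuclideanSpace ℝ (Fin 2) ≃ₜ EuclideanSpace ℝ (Fin 2))) :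
    ∃ S : Set (EuclideanSpace ℝ (Fin 2) ≃ₜ EuclideanSpace ℝ (Fin 2)),
      S.Finite ∧ S.ncard = 9 ∧
      ∀ n, ∃ L : List (EuclideanSpace ℝ (Fin 2) ≃ₜ EuclideanSpace ℝ (Fin 2)),
        L.length ≤ 26 * n + 12 ∧ (∀ x ∈ L, x ∈ S ∨ x⁻¹ ∈ S) ∧ h n = L.prod := by
  let φ := conjEquiv Complex.orthonormalBasisOneI.repr.toHomeomorph
  have hmem' : ∀ n, φ.symm (h n) ∈ tame ℂ := fun n => by
    refine commutator_le_tame ?_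
    have h1 := Subgroup.mem_map_of_mem φ.symm.toMonoidHom (hmem n)
    rw [commutator_def, Subgroup.map_commutator] at h1
    exact Subgroup.commutator_mono le_top le_top h1
  obtain ⟨S, hS, hS9, hw⟩ := exists_words_of_tame (fun n => φ.symm (h n)) hmem'
    fun n => (tame ℂ).inv_mem (hmem' n)
  have := infinite_homeomorph_complex
  obtain ⟨T, hST, hT⟩ := Infinite.exists_superset_card_eq hS.toFinset 9
    (by rwa [← Set.ncard_eq_toFinset_card S hS])
  refine ⟨φ '' T, T.finite_toSet.image _, ?_, fun n => ?_⟩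
  · rw [Set.ncard_image_of_injective _ φ.injective, Set.ncard_coe_finset, hT]
  · have h1 := ((hw n).mono (S' := T) (fun x hx => hST (hS.mem_toFinset.2 hx)) le_rfl).map
      φ.toMonoidHom
    simpa [Word] using h1
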